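/- arXiv:2401.01760 — 3 statements merged into one kernel-verified Lean document; each statement's English description precedes it below -/
import Mathlib

section
/- For every n ≥ 0 and all real numbers x, y, s, t: Σ_{π ∈ S_{n+1}} x^{basc(π)} y^{des(π)−plrmin(π)} s^{suc(π)} t^{plrmin(π)} = Σ_{σ ∈ SS_n} (s+t)^{fix(σ)} (2xy)^{exc(σ)} (x+y)^{n − fix(σ) − 2·exc(σ)}. In particular this polynomial is symmetric in the variables s and t as well as in x and y. -/
open Finset

namespace SucEuler

/-- One-line notation word of a permutation: `word π i` is the value (in `1..n`)
at position `i ∈ {1,…,n}`, and `0` for positions outside `{1,…,n}`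
(this implements the conventions `π(0)=π(n+1)=0`). -/
def word {n : ℕ} (π : Equiv.Perm (Fin n)) (i : ℕ) : ℕ :=
  if h : 1 ≤ i ∧ i ≤ n then ((π ⟨i - 1, by omega⟩ : Fin n) : ℕ) + 1 else 0

/-- number of descents -/
def des {n : ℕ} (π : Equiv.Perm (Fin n)) : ℕ :=
  ((Finset.Icc 1 (n - 1)).filter fun i => word π (i + 1) < word π i).card

/-- number of ascents -/
def asc {n : ℕ} (π : Equiv.Perm (Fin n)) : ℕ :=
  ((Finset.Icc 1 (n - 1)).filter fun i => word π i < word π (i + 1)).card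

/-- number of successions -/
def suc {n : ℕ} (π : Equiv.Perm (Fin n)) : ℕ :=
  ((Finset.Icc 1 (n - 1)).filter fun i => word π (i + 1) = word π i + 1).card

/-- number of big ascents -/
def basc {n : ℕ} (π : Equiv.Perm (Fin n)) : ℕ :=
  ((Finset.Icc 1 (n - 1)).filter fun i => word π i + 2 ≤ word π (i + 1)).card

/-- number of excedances -/
def excStat {n : ℕ} (σ : Equiv.Perm (Fin n)) : ℕ :=
  (Finset.univ.filter fun i : Fin n => i < σ i).card

/-- number of fixed points -/
def fixStat {n : ℕ} (σ : Equiv.Perm (Fin n)) : ℕ :=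
  (Finset.univ.filter fun i : Fin n => σ i = i).card

/-- number of drops -/
def dropStat {n : ℕ} (σ : Equiv.Perm (Fin n)) : ℕ :=
  (Finset.univ.filter fun i : Fin n => σ i < i).card

/-- number of excedances at positions `i ≥ 2` -/
def excHat {n : ℕ} (σ : Equiv.Perm (Fin n)) : ℕ :=
  (Finset.univ.filter fun i : Fin n => 0 < (i : ℕ) ∧ i < σ i).card

/-- number of fixed points other than `1` -/
def fixHat {n : ℕ} (σ : Equiv.Perm (Fin n)) : ℕ :=
  (Finset.univ.filter fun i : Fin n => 0 < (i : ℕ) ∧ σ i = i).card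

/-- number of cycles (orbits) of a permutation -/
def cyc {n : ℕ} (σ : Equiv.Perm (Fin n)) : ℕ :=
  σ.cycleType.card + fixStat σ

/-- number of cycle double ascents: values `x` with `σ⁻¹(x) < x < σ(x)` -/
def cda {n : ℕ} (σ : Equiv.Perm (Fin n)) : ℕ :=
  (Finset.univ.filter fun x : Fin n => σ⁻¹ x < x ∧ x < σ x).card

open Classical in
/-- number of left-to-right minima -/
noncomputable def lrmin {n : ℕ} (π : Equiv.Perm (Fin n)) : ℕ :=
  ((Finset.Icc 1 n).filter fun i => ∀ j ∈ Finset.Icc 1 n, j < i → word π i < word π j).card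

open Classical in
/-- number of proper left-to-right minima -/
noncomputable def plrmin {n : ℕ} (π : Equiv.Perm (Fin n)) : ℕ :=
  ((Finset.Icc 1 n).filter fun i =>
    (∀ j ∈ Finset.Icc 1 n, j < i → word π i < word π j) ∧ word π i ≠ 1 ∧
      ∃ k ∈ Finset.Icc 1 n, i < k ∧ word π k = word π i - 1 ∧ word π (k + 1) < word π k).card

open Classical in
/-- number of simsun successions -/
noncomputable def simsuc {n : ℕ} (π : Equiv.Perm (Fin n)) : ℕ :=
  ((Finset.Icc 1 n).filter fun i =>
    ∃ j ∈ Finset.Icc 1 n, i < j ∧ word π j = word π i + 1 ∧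
      ∀ k ∈ Finset.Icc 1 n, i < k → k < j → word π i + 1 < word π k).card

/-- number of peaks (with the boundary conventions `π(0)=π(n+1)=0`) -/
def pk {n : ℕ} (π : Equiv.Perm (Fin n)) : ℕ :=
  ((Finset.Icc 1 n).filter fun i => word π (i - 1) < word π i ∧ word π (i + 1) < word π i).card

/-- number of valleys -/
def valStat {n : ℕ} (π : Equiv.Perm (Fin n)) : ℕ :=
  ((Finset.Icc 1 n).filter fun i => word π i < word π (i - 1) ∧ word π i < word π (i + 1)).card

/-- number of double ascents -/
def dasc {n : ℕ} (π : Equiv.Perm (Fin n)) : ℕ :=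
  ((Finset.Icc 1 n).filter fun i => word π (i - 1) < word π i ∧ word π i < word π (i + 1)).card

/-- number of double descents -/
def ddes {n : ℕ} (π : Equiv.Perm (Fin n)) : ℕ :=
  ((Finset.Icc 1 n).filter fun i => word π (i + 1) < word π i ∧ word π i < word π (i - 1)).card

open Classical in
/-- `nextVal σ m x` is the (0-indexed) first value `≤ m` (i.e. `< m` in 0-indexed terms)
in the forward orbit of `x` under `σ`: it equals `σ^t(x)` for the minimal `t ≥ 1`
with `σ^t(x) < m`, when such `t` exists. This is the action of the permutation `σ_k`
(with `m = n - k`) obtained by removing the `k` largest letters from the cycles of `σ`. -/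
noncomputable def nextVal {n : ℕ} (σ : Equiv.Perm (Fin n)) (m : ℕ) (x : Fin n) : ℕ :=
  if h : ∃ t : ℕ, 0 < t ∧ (((σ ^ t) x : Fin n) : ℕ) < m then (((σ ^ Nat.find h) x : Fin n) : ℕ)
  else 0

/-- `σ` is a simsun permutation of the second kind: for every `0 ≤ k ≤ n-1`, the
permutation of `[n-k]` obtained from `σ` by removing the `k` largest letters has
no cycle double ascents. (Here `m = n - k` and values are 0-indexed.) -/
def IsSimsun2 {n : ℕ} (σ : Equiv.Perm (Fin n)) : Prop :=
  ∀ m ≤ n, ∀ x : Fin n, (x : ℕ) < m →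
    ¬ (nextVal σ⁻¹ m x < (x : ℕ) ∧ (x : ℕ) < nextVal σ m x)

noncomputable instance {n : ℕ} : DecidablePred (IsSimsun2 (n := n)) :=
  fun _ => Classical.propDecidable _

/-- the derangement polynomial `d_n(x)` -/
def dpoly (n : ℕ) (x : ℝ) : ℝ :=
  ∑ σ ∈ Finset.univ.filter fun σ : Equiv.Perm (Fin n) => fixStat σ = 0, x ^ excStat σ

/-- the Eulerian polynomial `A_n(x)` -/
def eulerian (n : ℕ) (x : ℝ) : ℝ :=
  ∑ π : Equiv.Perm (Fin n), x ^ des π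


lemma deriv_prod {R ι : Type*} [CommRing R] [Algebra ℝ R] [DecidableEq ι] (D : Derivation ℝ R R)
    (S : Finset ι) (f : ι → R) :
    D (∏ i ∈ S, f i) = ∑ i ∈ S, (∏ j ∈ S.erase i, f j) * D (f i) := by
  induction S using Finset.induction_on with
  | empty => simp
  | insert a S ha ih =>
    rw [Finset.prod_insert ha, Derivation.leibniz, ih, Finset.sum_insert ha,
      Finset.erase_insert ha, add_comm]
    simp only [smul_eq_mul, Finset.mul_sum]
    congr 1
    apply Finset.sum_congr rfl
    intro i hi
    have hne : a ≠ i := fun h => ha (h ▸ hi)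
    rw [Finset.erase_insert_of_ne hne, Finset.prod_insert (by simp [ha]), mul_assoc]

/-- insert the largest value at position `p` -/
def insP {n : ℕ} (p : Fin (n + 1)) (π : Equiv.Perm (Fin n)) : Equiv.Perm (Fin (n + 1)) :=
  (finSuccEquiv' p).trans ((Equiv.optionCongr π).trans (finSuccEquiv' (Fin.last n)).symm)

lemma insP_self {n : ℕ} (p : Fin (n + 1)) (π : Equiv.Perm (Fin n)) :
    insP p π p = Fin.last n := by simp [insP]

lemma insP_succAbove {n : ℕ} (p : Fin (n + 1)) (π : Equiv.Perm (Fin n)) (i : Fin n) :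
    insP p π (p.succAbove i) = (π i).castSucc := by simp [insP]

lemma insP_symm_last {n : ℕ} (p : Fin (n + 1)) (π : Equiv.Perm (Fin n)) :
    (insP p π).symm (Fin.last n) = p := by
  rw [Equiv.symm_apply_eq, insP_self]

lemma insP_symm_castSucc {n : ℕ} (p : Fin (n + 1)) (π : Equiv.Perm (Fin n)) (u : Fin n) :
    (insP p π).symm u.castSucc = p.succAbove (π.symm u) := by
  rw [Equiv.symm_apply_eq, insP_succAbove, Equiv.apply_symm_apply]

lemma insP_bij (n : ℕ) : Function.Bijective
    (fun q : Fin (n + 1) × Equiv.Perm (Fin n) => insP q.1 q.2) := by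
  rw [Fintype.bijective_iff_injective_and_card]
  constructor
  · rintro ⟨p, π⟩ ⟨q, τ⟩ h
    simp only at h
    have h1 : p = q := by
      rw [← insP_symm_last p π, h, insP_symm_last]
    subst h1
    congr 1
    ext i
    have := congrArg (fun e : Equiv.Perm (Fin (n + 1)) => e (p.succAbove i)) h
    simp only [insP_succAbove] at this
    have := Fin.castSucc_injective _ this
    rw [this]
  · simp [Fintype.card_perm, Nat.factorial_succ]

lemma word_insP {n : ℕ} (p : Fin (n + 1)) (π : Equiv.Perm (Fin n)) (j : ℕ) :
    word (insP p π) j = if j = p + 1 then n + 1 else if j < p + 1 then word π j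
      else word π (j - 1) := by
  have hp := p.isLt
  by_cases hj : 1 ≤ j ∧ j ≤ n + 1
  · split_ifs with h1 h2
    · have : (⟨j - 1, by omega⟩ : Fin (n + 1)) = p := by ext; simp; omega
      simp only [word, hj, and_self, dite_true, this, insP_self, Fin.val_last]
    · have : (⟨j - 1, by omega⟩ : Fin (n + 1)) = p.succAbove ⟨j - 1, by omega⟩ := by
        rw [Fin.succAbove_of_castSucc_lt]
        · rfl
        · rw [Fin.lt_def]; simp; omega
      have h3 : 1 ≤ j ∧ j ≤ n := by omega
      simp only [word, hj, h3, and_self, dite_true, this, insP_succAbove, Fin.val_castSucc]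
    · have : (⟨j - 1, by omega⟩ : Fin (n + 1)) = p.succAbove ⟨j - 1 - 1, by omega⟩ := by
        rw [Fin.succAbove_of_le_castSucc]
        · ext; simp; omega
        · rw [Fin.le_def]; simp; omega
      have h3 : 1 ≤ j - 1 ∧ j - 1 ≤ n := by omega
      simp only [word, hj, h3, and_self, dite_true, this, insP_succAbove, Fin.val_castSucc]
  · have h1 : j ≠ p + 1 := by omega
    rw [if_neg h1]
    simp only [word, hj, dite_false]
    split_ifs <;> first | rfl | omega

/-- the value following `u` (1-indexed, 0 at the end) -/
def nxt {n : ℕ} (π : Equiv.Perm (Fin n)) (u : Fin n) : ℕ := word π ((π.symm u : ℕ) + 2)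

lemma nxt_insP {n : ℕ} (p : Fin (n + 1)) (π : Equiv.Perm (Fin n)) (u : Fin n) :
    nxt (insP p π) u.castSucc = if p = (π.symm u).succ then n + 1 else nxt π u := by
  have hv : (p = (π.symm u).succ) ↔ (p : ℕ) = (π.symm u : ℕ) + 1 := by simp [Fin.ext_iff]
  simp only [nxt, insP_symm_castSucc, word_insP, hv]
  by_cases h : (π.symm u).castSucc < p
  · rw [Fin.succAbove_of_castSucc_lt _ _ h]
    rw [Fin.lt_def] at h
    simp at h ⊢
    split_ifs <;> first | rfl | omega
  · rw [Fin.succAbove_of_le_castSucc _ _ (not_lt.1 h)]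
    rw [Fin.lt_def] at h
    simp at h ⊢
    split_ifs <;> first | rfl | omega

lemma word_le {n : ℕ} (π : Equiv.Perm (Fin n)) (i : ℕ) : word π i ≤ n := by
  unfold word; split_ifs <;> omega

/-- the value `v` is a left-to-right minimum -/
def LR {n : ℕ} (π : Equiv.Perm (Fin n)) (v : Fin n) : Prop := ∀ u < v, π.symm v < π.symm u

lemma LR_castSucc {n : ℕ} (p : Fin (n + 1)) (π : Equiv.Perm (Fin n)) (u : Fin n) :
    LR (insP p π) u.castSucc ↔ LR π u := by
  constructor
  · intro h w hw
    have := h w.castSucc (by simpa using hw)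
    rwa [insP_symm_castSucc, insP_symm_castSucc, Fin.succAbove_lt_succAbove_iff] at this
  · intro h w hw
    induction w using Fin.lastCases with
    | last => exact absurd hw (not_lt.2 (Fin.le_last _))
    | cast w =>
      rw [insP_symm_castSucc, insP_symm_castSucc, Fin.succAbove_lt_succAbove_iff]
      exact h w (by simpa using hw)

lemma LR_last {n : ℕ} (p : Fin (n + 1)) (π : Equiv.Perm (Fin n)) :
    LR (insP p π) (Fin.last n) ↔ p = 0 := by
  constructor
  · intro h
    by_contra hp
    obtain ⟨i, rfl⟩ := Fin.exists_succ_eq.2 hp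
    have := h (π i).castSucc (Fin.castSucc_lt_last _)
    rw [insP_symm_last, insP_symm_castSucc, Equiv.symm_apply_apply,
      Fin.succAbove_of_castSucc_lt _ _ (Fin.castSucc_lt_succ)] at this
    exact absurd this (not_lt.2 (Fin.castSucc_lt_succ).le)
  · rintro rfl w hw
    induction w using Fin.lastCases with
    | last => exact absurd hw (lt_irrefl _)
    | cast w =>
      rw [insP_symm_last, insP_symm_castSucc]
      simp

open Classical in
noncomputable def labP {R : Type*} (x y s t : R) {n : ℕ} (π : Equiv.Perm (Fin (n + 1)))
    (v : Fin n) : R :=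
  if nxt π v.castSucc = v + 2 then s else if (v : ℕ) + 2 < nxt π v.castSucc then x
    else if LR π v.succ then t else y

lemma labP_castSucc {R : Type*} (x y s t : R) {n : ℕ} (p : Fin (n + 2))
    (π : Equiv.Perm (Fin (n + 1))) (v : Fin n) :
    labP x y s t (insP p π) v.castSucc =
      if p = (π.symm v.castSucc).succ then x else labP x y s t π v := by
  unfold labP
  rw [nxt_insP, Fin.succ_castSucc, LR_castSucc]
  by_cases h : p = (π.symm v.castSucc).succ
  · have := v.isLt
    simp only [h, if_true, Fin.val_castSucc]
    rw [if_neg (by omega), if_pos (by omega)]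
  · simp only [h, if_false, Fin.val_castSucc]

lemma labP_last {R : Type*} (x y s t : R) {n : ℕ} (p : Fin (n + 2))
    (π : Equiv.Perm (Fin (n + 1))) :
    labP x y s t (insP p π) (Fin.last n) =
      if p = (π.symm (Fin.last n)).succ then s else if p = 0 then t else y := by
  unfold labP
  rw [nxt_insP, Fin.succ_last, LR_last]
  by_cases h : p = (π.symm (Fin.last n)).succ
  · simp only [h, if_true, Fin.val_last]
  · simp only [h, if_false, Fin.val_last]
    have : nxt π (Fin.last n) ≤ n + 1 := word_le _ _
    rw [if_neg (by omega), if_neg (by omega)]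
    congr

lemma recP1 {R : Type*} [CommRing R] [Algebra ℝ R] (D : Derivation ℝ R R) (x y s t : R)
    (hx : D x = x * y) (hy : D y = x * y) (hs : D s = x * y) (ht : D t = x * y)
    {n : ℕ} (π : Equiv.Perm (Fin (n + 1))) :
    ∑ p, ∏ v, labP x y s t (insP p π) v =
      (s + t) * ∏ v, labP x y s t π v + D (∏ v, labP x y s t π v) := by
  have hlab : ∀ v, D (labP x y s t π v) = x * y := by
    intro v; unfold labP; split_ifs <;> assumption
  rw [deriv_prod, Fin.sum_univ_succ, ← Equiv.sum_comp π.symm, Fin.sum_univ_castSucc]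
  simp only [Fin.prod_univ_castSucc, labP_castSucc, labP_last, hlab]
  have e0 : ∀ i : Fin (n + 1), (0 : Fin (n + 2)) = i.succ ↔ False := fun i => by
    simp [(Fin.succ_ne_zero i).symm]
  simp only [e0, Fin.succ_inj, EmbeddingLike.apply_eq_iff_eq, Fin.succ_ne_zero, if_false, if_true]
  have e1 : ∀ i : Fin n, (Fin.last n = i.castSucc) ↔ False := fun i => by
    simp [(Fin.castSucc_lt_last i).ne']
  have e2 : ∀ i : Fin n, (i.castSucc = Fin.last n) ↔ False := fun i => by
    simp [(Fin.castSucc_lt_last i).ne]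
  simp only [e1, e2, if_false, Fin.castSucc_inj]
  have key : ∀ i : Fin n, ∏ j, (if i = j then x else labP x y s t π j) =
      x * ∏ j ∈ univ.erase i, labP x y s t π j := by
    intro i
    rw [← Finset.mul_prod_erase _ _ (Finset.mem_univ i), if_pos rfl]
    congr 1
    apply Finset.prod_congr rfl
    intro j hj
    rw [if_neg (Finset.ne_of_mem_erase hj).symm]
  simp only [key]
  rw [add_mul]
  have : ∀ i : Fin n, x * (∏ j ∈ univ.erase i, labP x y s t π j) * y =
     (∏ j ∈ univ.erase i, labP x y s t π j) * (x * y) := fun i => by ring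
  simp only [this]
  ring

lemma recP {R : Type*} [CommRing R] [Algebra ℝ R] (D : Derivation ℝ R R) (x y s t : R)
    (hx : D x = x * y) (hy : D y = x * y) (hs : D s = x * y) (ht : D t = x * y) (n : ℕ) :
    ∑ π : Equiv.Perm (Fin (n + 2)), ∏ v, labP x y s t π v =
      (s + t) * ∑ π : Equiv.Perm (Fin (n + 1)), ∏ v, labP x y s t π v
        + D (∑ π : Equiv.Perm (Fin (n + 1)), ∏ v, labP x y s t π v) := by
  rw [← (insP_bij (n + 1)).sum_comp, Fintype.sum_prod_type_right, map_sum, Finset.mul_sum,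
    ← Finset.sum_add_distrib]
  exact Finset.sum_congr rfl fun π _ => recP1 D x y s t hx hy hs ht π

lemma word_pos {n : ℕ} (π : Equiv.Perm (Fin n)) (u : Fin n) :
    word π ((π.symm u : ℕ) + 1) = u + 1 := by
  have h : 1 ≤ (π.symm u : ℕ) + 1 ∧ (π.symm u : ℕ) + 1 ≤ n := by
    have := (π.symm u).isLt; omega
  simp only [word, h, and_self, dite_true]
  simp

lemma exists_pos {n : ℕ} (π : Equiv.Perm (Fin n)) (i : ℕ) (hi : i ∈ Finset.Icc 1 n) :
    ∃ u : Fin n, i = (π.symm u : ℕ) + 1 := by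
  rw [Finset.mem_Icc] at hi
  refine ⟨π ⟨i - 1, by omega⟩, ?_⟩
  simp; omega

lemma pos_mem {n : ℕ} (π : Equiv.Perm (Fin n)) (u : Fin n) :
    (π.symm u : ℕ) + 1 ∈ Finset.Icc 1 n := by
  have := (π.symm u).isLt
  rw [Finset.mem_Icc]; omega

lemma nxt_ne {n : ℕ} (π : Equiv.Perm (Fin n)) (u : Fin n) : nxt π u ≠ u + 1 := by
  unfold nxt
  by_cases h : (π.symm u : ℕ) + 2 ∈ Finset.Icc 1 n
  · obtain ⟨w, hw⟩ := exists_pos π _ h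
    rw [hw, word_pos]
    intro h2
    have : w = u := by ext; omega
    subst this
    omega
  · rw [Finset.mem_Icc] at h
    rw [word, dif_neg (by omega)]
    omega

lemma card_Q {n : ℕ} (π : Equiv.Perm (Fin (n + 1))) (Q : ℕ → ℕ → Prop)
    [∀ a b, Decidable (Q a b)] (hQ : ∀ a b, Q a b → a < b) :
    (univ.filter fun v : Fin n => Q (v + 1) (nxt π v.castSucc)).card =
      ((Finset.Icc 1 (n + 1 - 1)).filter fun i => Q (word π i) (word π (i + 1))).card := by
  apply Finset.card_bij (fun v _ => (π.symm v.castSucc : ℕ) + 1)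
  · intro v hv
    rw [Finset.mem_filter] at hv ⊢
    rw [word_pos]
    refine ⟨?_, hv.2⟩
    have h1 := hQ _ _ hv.2
    have h2 := (π.symm v.castSucc).isLt
    by_contra h3
    rw [Finset.mem_Icc] at h3
    rw [nxt, word, dif_neg (by omega)] at h1
    omega
  · intro v _ w _ h
    have : π.symm v.castSucc = π.symm w.castSucc := by ext; omega
    simpa using this
  · intro i hi
    rw [Finset.mem_filter, Finset.mem_Icc] at hi
    obtain ⟨u, rfl⟩ := exists_pos π i (by rw [Finset.mem_Icc]; omega)
    have h1 := hi.2
    rw [word_pos] at h1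
    have h2 := hQ _ _ h1
    have h3 := word_le π ((π.symm u : ℕ) + 1 + 1)
    refine ⟨⟨u, by omega⟩, ?_, rfl⟩
    rw [Finset.mem_filter]
    exact ⟨Finset.mem_univ _, h1⟩

lemma LR_iff {n : ℕ} (π : Equiv.Perm (Fin n)) (u : Fin n) :
    (∀ j ∈ Finset.Icc 1 n, j < (π.symm u : ℕ) + 1 →
      word π ((π.symm u : ℕ) + 1) < word π j) ↔ LR π u := by
  rw [word_pos]
  constructor
  · intro h w hw
    by_contra h2
    have h3 : π.symm w ≠ π.symm u := by simpa using hw.ne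
    have h4 : π.symm w < π.symm u := lt_of_le_of_ne (not_lt.1 h2) h3
    have := h _ (pos_mem π w) (by rw [Fin.lt_def] at h4; omega)
    rw [word_pos] at this
    rw [Fin.lt_def] at hw
    omega
  · intro h j hj hju
    obtain ⟨w, rfl⟩ := exists_pos π j hj
    rw [word_pos]
    by_contra h2
    rcases lt_trichotomy w u with h3 | h3 | h3
    · have := h w h3
      rw [Fin.lt_def] at this; omega
    · subst h3; omega
    · rw [Fin.lt_def] at h3; omega

lemma mem_filter_any {α : Type*} {p : α → Prop} {inst : DecidablePred p} {S : Finset α} {a : α} :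
    a ∈ @Finset.filter α p inst S ↔ a ∈ S ∧ p a := Finset.mem_filter

open Classical in
lemma card_plr {n : ℕ} (π : Equiv.Perm (Fin (n + 1))) :
    (univ.filter fun v : Fin n => nxt π v.castSucc < v + 1 ∧ LR π v.succ).card = plrmin π := by
  unfold plrmin
  apply Finset.card_bij (fun v _ => (π.symm v.succ : ℕ) + 1)
  · intro v hv
    replace hv := mem_filter_any.1 hv
    refine mem_filter_any.2 ⟨pos_mem _ _, (LR_iff _ _).2 hv.2.2, ?_, ?_⟩
    · rw [word_pos]; simp
    · refine ⟨(π.symm v.castSucc : ℕ) + 1, pos_mem _ _, ?_, ?_, ?_⟩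
      · have := hv.2.2 v.castSucc (Fin.castSucc_lt_succ)
        rw [Fin.lt_def] at this; omega
      · rw [word_pos, word_pos]; simp
      · rw [word_pos]; exact hv.2.1
  · intro v _ w _ h
    have : π.symm v.succ = π.symm w.succ := by ext; omega
    simpa using this
  · intro i hi
    replace hi := mem_filter_any.1 hi
    obtain ⟨h0, h1, h2, k, hk, hik, h3, h4⟩ := hi
    obtain ⟨u, rfl⟩ := exists_pos π i h0
    obtain ⟨w, rfl⟩ := exists_pos π k hk
    rw [LR_iff] at h1
    rw [word_pos] at h2 h3 h4
    rw [word_pos] at h3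
    have hu := u.isLt
    obtain ⟨v, rfl⟩ := Fin.exists_succ_eq.2 (show u ≠ 0 by rintro rfl; simp at h2)
    have hw : w = v.castSucc := by ext; simp at h3 ⊢; omega
    subst hw
    refine ⟨v, ?_, rfl⟩
    rw [Finset.mem_filter]
    exact ⟨Finset.mem_univ _, h4, h1⟩

lemma word_succ_ne {n : ℕ} (π : Equiv.Perm (Fin n)) (i : ℕ) (hi : i ∈ Finset.Icc 1 n) :
    word π (i + 1) ≠ word π i := by
  obtain ⟨u, rfl⟩ := exists_pos π i hi
  rw [word_pos]; exact nxt_ne π u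

lemma stat_sum {n : ℕ} (π : Equiv.Perm (Fin (n + 1))) : suc π + basc π + des π = n := by
  unfold suc basc des
  simp only [Finset.card_filter]
  rw [← Finset.sum_add_distrib, ← Finset.sum_add_distrib]
  trans ∑ i ∈ Finset.Icc 1 (n + 1 - 1), 1
  · apply Finset.sum_congr rfl
    intro i hi
    have h1 := word_succ_ne π i (by rw [Finset.mem_Icc] at hi ⊢; omega)
    split_ifs <;> omega
  · simp

lemma prodP {R : Type*} [CommRing R] (x y s t : R) {n : ℕ} (π : Equiv.Perm (Fin (n + 1))) :
    ∏ v, labP x y s t π v =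
      x ^ basc π * y ^ (des π - plrmin π) * s ^ suc π * t ^ plrmin π := by
  classical
  have hA : (univ.filter fun v : Fin n => nxt π v.castSucc = v + 2).card = suc π :=
    card_Q π (fun a b => b = a + 1) (by intros; omega)
  have hB : (univ.filter fun v : Fin n => (v : ℕ) + 1 + 2 ≤ nxt π v.castSucc).card = basc π :=
    card_Q π (fun a b => a + 2 ≤ b) (by intros; omega)
  have hC := card_plr π
  have hE : (univ.filter fun v : Fin n => nxt π v.castSucc < v + 1 ∧ ¬ LR π v.succ).card
      = des π - plrmin π := by
    have h1 := stat_sum π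
    rw [← hA, ← hB] at h1
    rw [← hC]
    have : (univ.filter fun v : Fin n => nxt π v.castSucc = v + 2).card +
      (univ.filter fun v : Fin n => (v : ℕ) + 1 + 2 ≤ nxt π v.castSucc).card +
      (univ.filter fun v : Fin n => nxt π v.castSucc < v + 1 ∧ LR π v.succ).card +
      (univ.filter fun v : Fin n => nxt π v.castSucc < v + 1 ∧ ¬ LR π v.succ).card = n := by
      simp only [Finset.card_filter]
      rw [← Finset.sum_add_distrib, ← Finset.sum_add_distrib, ← Finset.sum_add_distrib]
      trans ∑ i : Fin n, 1
      · apply Finset.sum_congr rfl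
        intro v _
        have h1 := nxt_ne π v.castSucc
        rw [Fin.val_castSucc] at h1
        by_cases hL : LR π v.succ <;> simp only [hL, not_true, not_false_eq_true, and_true, and_false, if_false] <;>
        split_ifs <;> omega
      · simp
    omega
  rw [← hE, ← hC, ← hA, ← hB]
  simp only [← Finset.prod_const, Finset.prod_filter]
  rw [← Finset.prod_mul_distrib, ← Finset.prod_mul_distrib, ← Finset.prod_mul_distrib]
  apply Finset.prod_congr rfl
  intro v _
  have h1 := nxt_ne π v.castSucc
  rw [Fin.val_castSucc] at h1
  unfold labP
  by_cases hL : LR π v.succ <;> simp only [hL, not_true, not_false_eq_true, and_true, and_false, if_false, if_true] <;>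
  split_ifs <;> first | omega | simp

/-- insert the largest letter in the cycles of `σ` -/
def insC {n : ℕ} (p : Fin (n + 1)) (σ : Equiv.Perm (Fin n)) : Equiv.Perm (Fin (n + 1)) :=
  insP (Fin.last n) σ * Equiv.swap p (Fin.last n)

lemma ext_cast {n : ℕ} (σ : Equiv.Perm (Fin n)) (u : Fin n) :
    insP (Fin.last n) σ u.castSucc = (σ u).castSucc := by
  rw [← insP_succAbove (Fin.last n) σ u, Fin.succAbove_last]

lemma insC_self {n : ℕ} (p : Fin (n + 1)) (σ : Equiv.Perm (Fin n)) :
    insC p σ p = Fin.last n := by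
  simp [insC, insP_self]

lemma insC_last {n : ℕ} (p : Fin (n + 1)) (σ : Equiv.Perm (Fin n)) :
    insC p σ (Fin.last n) = insP (Fin.last n) σ p := by
  simp [insC]

lemma insC_cast {n : ℕ} (p : Fin (n + 1)) (σ : Equiv.Perm (Fin n)) (u : Fin n)
    (h : u.castSucc ≠ p) : insC p σ u.castSucc = (σ u).castSucc := by
  rw [insC, Equiv.Perm.mul_apply, Equiv.swap_apply_of_ne_of_ne h (Fin.castSucc_lt_last u).ne,
    ext_cast]

lemma ext_inv {n : ℕ} (σ : Equiv.Perm (Fin n)) :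
    (insP (Fin.last n) σ)⁻¹ = insP (Fin.last n) σ⁻¹ := by
  rw [inv_eq_iff_mul_eq_one]
  ext i
  rw [Equiv.Perm.mul_apply]
  induction i using Fin.lastCases with
  | last => simp [insP_self]
  | cast i => simp [ext_cast]

lemma insC_inv {n : ℕ} (p : Fin (n + 1)) (σ : Equiv.Perm (Fin n)) :
    (insC p σ)⁻¹ = insC (insP (Fin.last n) σ p) σ⁻¹ := by
  rw [insC, insC, mul_inv_rev, Equiv.swap_inv, ← ext_inv]
  have := Equiv.swap_apply_apply (insP (Fin.last n) σ) p (Fin.last n)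
  rw [insP_self] at this
  rw [this]
  group

lemma insC_bij (n : ℕ) : Function.Bijective
    (fun q : Fin (n + 1) × Equiv.Perm (Fin n) => insC q.1 q.2) := by
  rw [Fintype.bijective_iff_injective_and_card]
  constructor
  · rintro ⟨p, π⟩ ⟨q, τ⟩ h
    simp only at h
    have h1 : p = q := by
      apply (insC p π).injective
      rw [insC_self, h, insC_self]
    subst h1
    have h2 := mul_right_cancel h
    have := (insP_bij n).injective (a₁ := (Fin.last n, π)) (a₂ := (Fin.last n, τ)) h2
    simp only [Prod.mk.injEq, true_and] at this
    rw [this]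
  · simp [Fintype.card_perm, Nat.factorial_succ]

/-- the graph of `nextVal` -/
inductive Nx {n : ℕ} (σ : Equiv.Perm (Fin n)) (m : ℕ) : Fin n → ℕ → Prop
  | base (x : Fin n) (h : (σ x : ℕ) < m) : Nx σ m x (σ x)
  | step (x : Fin n) (y : ℕ) (h : ¬ (σ x : ℕ) < m) (h2 : Nx σ m (σ x) y) : Nx σ m x y

lemma Nx_pow {n : ℕ} {σ : Equiv.Perm (Fin n)} {m : ℕ} {x : Fin n} {y : ℕ} (h : Nx σ m x y) :
    ∃ t, 0 < t ∧ (((σ ^ t) x : Fin n) : ℕ) = y ∧ y < m ∧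
      ∀ r, 0 < r → r < t → ¬ (((σ ^ r) x : Fin n) : ℕ) < m := by
  induction h with
  | base x h => exact ⟨1, one_pos, by simp, h, by intros; omega⟩
  | step x y h _ ih =>
    obtain ⟨t, ht, h1, h2, h3⟩ := ih
    refine ⟨t + 1, by omega, ?_, h2, ?_⟩
    · rw [pow_succ, Equiv.Perm.mul_apply]; exact h1
    · intro r hr hrt
      obtain ⟨r, rfl⟩ : ∃ r', r = r' + 1 := ⟨r - 1, by omega⟩
      rw [pow_succ, Equiv.Perm.mul_apply]
      by_cases hr0 : r = 0
      · subst hr0; simpa using h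
      · exact h3 r (by omega) (by omega)

lemma Nx_nextVal {n : ℕ} {σ : Equiv.Perm (Fin n)} {m : ℕ} {x : Fin n} {y : ℕ} (h : Nx σ m x y) :
    nextVal σ m x = y := by
  classical
  obtain ⟨t, ht, h1, h2, h3⟩ := Nx_pow h
  have hex : ∃ t : ℕ, 0 < t ∧ (((σ ^ t) x : Fin n) : ℕ) < m := ⟨t, ht, by omega⟩
  rw [nextVal, dif_pos hex]
  have : Nat.find hex = t := by
    rw [Nat.find_eq_iff]
    exact ⟨⟨ht, by omega⟩, fun r hr hh => h3 r hh.1 hr hh.2⟩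
  rw [this, h1]

lemma Nx_exists {n : ℕ} (σ : Equiv.Perm (Fin n)) (m : ℕ) (x : Fin n) (hx : (x : ℕ) < m) :
    ∃ y, Nx σ m x y := by
  have key : ∀ t : ℕ, ∀ x : Fin n, (((σ ^ (t + 1)) x : Fin n) : ℕ) < m → ∃ y, Nx σ m x y := by
    intro t
    induction t with
    | zero => intro x h; exact ⟨_, Nx.base x (by simpa using h)⟩
    | succ t ih =>
      intro x h
      by_cases h1 : (σ x : ℕ) < m
      · exact ⟨_, Nx.base x h1⟩
      · rw [pow_succ, Equiv.Perm.mul_apply] at h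
        obtain ⟨y, hy⟩ := ih (σ x) h
        exact ⟨y, Nx.step x y h1 hy⟩
  apply key (orderOf σ - 1) x
  have := orderOf_pos σ
  rw [Nat.sub_add_cancel this, pow_orderOf_eq_one]
  exact hx

lemma Nx_insC {n : ℕ} {σ : Equiv.Perm (Fin n)} {m : ℕ} {x : Fin n} {y : ℕ} (h : Nx σ m x y)
    (hm : m ≤ n) (p : Fin (n + 1)) : Nx (insC p σ) m x.castSucc y := by
  have aux : ∀ x : Fin n, ∀ y, (insC p σ x.castSucc = (σ x).castSucc → Nx (insC p σ) m x.castSucc y)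
      → (insC p σ (Fin.last n) = (σ x).castSucc → Nx (insC p σ) m (Fin.last n) y) →
      Nx (insC p σ) m x.castSucc y := by
    intro x y h1 h2
    by_cases hp : x.castSucc = p
    · have h3 : insC p σ x.castSucc = Fin.last n := by rw [hp, insC_self]
      apply Nx.step
      · rw [h3]; simp; exact hm
      · rw [h3]; apply h2; rw [insC_last, ← hp, ext_cast]
    · exact h1 (insC_cast p σ x hp)
  induction h with
  | base x h =>
    apply aux
    · intro h1
      have := Nx.base (σ := insC p σ) (m := m) x.castSucc (by rw [h1]; simpa using h)
      rw [h1] at this; simpa using this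
    · intro h1
      have := Nx.base (σ := insC p σ) (m := m) (Fin.last n) (by rw [h1]; simpa using h)
      rw [h1] at this; simpa using this
  | step x y h _ ih =>
    apply aux
    · intro h1
      apply Nx.step
      · rw [h1]; simpa using h
      · rw [h1]; exact ih
    · intro h1
      apply Nx.step
      · rw [h1]; simpa using h
      · rw [h1]; exact ih

lemma nextVal_insC {n : ℕ} (σ : Equiv.Perm (Fin n)) (m : ℕ) (x : Fin n) (hx : (x : ℕ) < m)
    (hm : m ≤ n) (p : Fin (n + 1)) : nextVal (insC p σ) m x.castSucc = nextVal σ m x := by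
  obtain ⟨y, hy⟩ := Nx_exists σ m x hx
  rw [Nx_nextVal hy, Nx_nextVal (Nx_insC hy hm p)]

lemma nextVal_full {n : ℕ} (σ : Equiv.Perm (Fin n)) (x : Fin n) : nextVal σ n x = σ x :=
  Nx_nextVal (Nx.base x (σ x).isLt)

/-- no cycle double ascents -/
def CF {n : ℕ} (σ : Equiv.Perm (Fin n)) : Prop := ∀ x, ¬ (σ⁻¹ x < x ∧ x < σ x)

noncomputable instance {n : ℕ} : DecidablePred (CF (n := n)) :=
  fun _ => Classical.propDecidable _

lemma CF_of {n : ℕ} {σ : Equiv.Perm (Fin n)} (h : IsSimsun2 σ) : CF σ := by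
  intro x hx
  apply h n le_rfl x x.isLt
  rw [nextVal_full, nextVal_full]
  exact hx

lemma simsun_insC {n : ℕ} (p : Fin (n + 1)) (σ : Equiv.Perm (Fin n)) :
    IsSimsun2 (insC p σ) ↔ IsSimsun2 σ ∧ CF (insC p σ) := by
  constructor
  · intro h
    refine ⟨?_, CF_of h⟩
    intro m hm x hx
    have := h m (by omega) x.castSucc (by simpa using hx)
    rw [insC_inv, nextVal_insC _ _ _ hx hm, nextVal_insC _ _ _ hx hm] at this
    simpa using this
  · rintro ⟨h, h2⟩ m hm x hx
    by_cases hmn : m = n + 1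
    · subst hmn
      rw [nextVal_full, nextVal_full]
      exact h2 x
    · have hm' : m ≤ n := by omega
      obtain ⟨x, rfl⟩ : ∃ x' : Fin n, x = x'.castSucc := ⟨⟨x, by omega⟩, rfl⟩
      have hx' : (x : ℕ) < m := by simpa using hx
      rw [insC_inv, nextVal_insC _ _ _ hx' hm', nextVal_insC _ _ _ hx' hm']
      simpa using h m hm' x hx'

def labC {R : Type*} [CommRing R] (a b c : R) {n : ℕ} (σ : Equiv.Perm (Fin n)) (x : Fin n) : R :=
  if σ x = x then a else if x < σ x then b else if σ⁻¹ x < x then 1 else c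

lemma insC_inv_cast {n : ℕ} (i : Fin n) (σ : Equiv.Perm (Fin n)) (u : Fin n) :
    (insC i.castSucc σ)⁻¹ u.castSucc = if u = σ i then Fin.last n else (σ⁻¹ u).castSucc := by
  rw [insC_inv, ext_cast]
  split_ifs with h
  · rw [h, insC_self]
  · rw [insC_cast]; simpa using h

lemma insC_cast' {n : ℕ} (i : Fin n) (σ : Equiv.Perm (Fin n)) (u : Fin n) :
    (insC i.castSucc σ) u.castSucc = if u = i then Fin.last n else (σ u).castSucc := by
  split_ifs with h
  · rw [h, insC_self]
  · rw [insC_cast]; simpa using h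

lemma insC_inv_lt {n : ℕ} (i : Fin n) (σ : Equiv.Perm (Fin n)) (u : Fin n) :
    (insC i.castSucc σ)⁻¹ u.castSucc < u.castSucc ↔ u ≠ σ i ∧ σ⁻¹ u < u := by
  rw [insC_inv_cast]
  split_ifs with h
  · simp [h, Fin.le_last]
  · simp [h]

lemma CF_cast {n : ℕ} (i : Fin n) {σ : Equiv.Perm (Fin n)} (hσ : CF σ) :
    CF (insC i.castSucc σ) ↔ ¬ σ⁻¹ i < i := by
  constructor
  · intro h hi
    apply h i.castSucc
    rw [insC_inv_lt, insC_cast', if_pos rfl]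
    refine ⟨⟨?_, hi⟩, Fin.castSucc_lt_last i⟩
    intro h2
    have : σ⁻¹ i = i := by rw [Equiv.Perm.inv_eq_iff_eq]; exact h2
    rw [this] at hi
    exact lt_irrefl _ hi
  · intro h x hx
    induction x using Fin.lastCases with
    | last => exact absurd hx.2 (not_lt.2 (Fin.le_last _))
    | cast u =>
      rw [insC_inv_lt, insC_cast'] at hx
      split_ifs at hx with hu
      · subst hu; exact h hx.1.2
      · exact hσ u ⟨hx.1.2, by simpa using hx.2⟩

lemma CF_last {n : ℕ} {σ : Equiv.Perm (Fin n)} (hσ : CF σ) : CF (insC (Fin.last n) σ) := by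
  intro x hx
  induction x using Fin.lastCases with
  | last => exact absurd hx.2 (not_lt.2 (Fin.le_last _))
  | cast u =>
    rw [insC_inv, insP_self, insC_cast _ _ _ (Fin.castSucc_lt_last u).ne,
      insC_cast _ _ _ (Fin.castSucc_lt_last u).ne] at hx
    exact hσ u (by simpa using hx)

lemma prod_last {R : Type*} [CommRing R] (a b c : R) {n : ℕ} (σ : Equiv.Perm (Fin n)) :
    ∏ x, labC a b c (insC (Fin.last n) σ) x = a * ∏ x, labC a b c σ x := by
  rw [Fin.prod_univ_castSucc, mul_comm]
  congr 1
  · simp [labC, insC_self]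
  · apply Finset.prod_congr rfl
    intro u _
    unfold labC
    rw [insC_inv, insP_self, insC_cast _ _ _ (Fin.castSucc_lt_last u).ne,
      insC_cast _ _ _ (Fin.castSucc_lt_last u).ne]
    simp

lemma prod_cast {R : Type*} [CommRing R] (a b c : R) {n : ℕ} {σ : Equiv.Perm (Fin n)}
    (hσ : CF σ) (i : Fin n) :
    ∏ x, labC a b c (insC i.castSucc σ) x =
      (∏ x ∈ univ.erase i, labC a b c σ x) * (b * if i < σ i then c else 1) := by
  rw [Fin.prod_univ_castSucc]
  have h1 : labC a b c (insC i.castSucc σ) (Fin.last n) = 1 := by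
    unfold labC
    rw [insC_last, ext_cast, insC_inv, ext_cast, insC_last, ext_cast]
    rw [if_neg (Fin.castSucc_lt_last _).ne, if_neg (not_lt.2 (Fin.le_last _)),
      if_pos (Fin.castSucc_lt_last _)]
  rw [h1, mul_one, ← Finset.mul_prod_erase _ _ (Finset.mem_univ i)]
  have h2 : labC a b c (insC i.castSucc σ) i.castSucc = b := by
    unfold labC
    rw [insC_self, if_neg (Fin.castSucc_lt_last _).ne', if_pos (Fin.castSucc_lt_last _)]
  rw [h2]
  have h3 : ∀ u ∈ univ.erase i, labC a b c (insC i.castSucc σ) u.castSucc =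
      labC a b c σ u * (if u = σ i then (if i < σ i then c else 1) else 1) := by
    intro u hu
    have hui := Finset.ne_of_mem_erase hu
    unfold labC
    rw [insC_cast', if_neg hui]
    simp only [insC_inv_lt, Fin.castSucc_inj, Fin.castSucc_lt_castSucc_iff]
    by_cases h : u = σ i
    · have hinv : σ⁻¹ u = i := by rw [h]; simp
      have hc := hσ u
      have hne : σ u ≠ u := by
        intro h4
        have h5 : σ u = σ i := by rw [h4, h]
        exact hui (σ.injective h5)
      rw [hinv] at hc ⊢
      rw [← h]
      simp only [hne, if_false, ne_eq, not_true, false_and, if_true]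
      by_cases h6 : i < u
      · have h7 : ¬ u < σ u := fun h7 => hc ⟨h6, h7⟩
        simp [h6, h7]
      · simp [h6]
    · simp [h]
  rw [Finset.prod_congr rfl h3, Finset.prod_mul_distrib, Finset.prod_ite_eq']
  by_cases h4 : i < σ i
  · rw [if_pos (by simp [h4.ne']), if_pos h4]; ring
  · rw [if_neg h4, ite_self]; ring

lemma recC1 {R : Type*} [CommRing R] [Algebra ℝ R] (D : Derivation ℝ R R) (a b c : R)
    (ha : D a = b) (hb : D b = b * c) (hc : D c = b) {n : ℕ} {σ : Equiv.Perm (Fin n)}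
    (hσ : CF σ) :
    (∑ p, if CF (insC p σ) then ∏ x, labC a b c (insC p σ) x else 0) =
      a * ∏ x, labC a b c σ x + D (∏ x, labC a b c σ x) := by
  rw [Fin.sum_univ_castSucc, if_pos (CF_last hσ), prod_last, deriv_prod, add_comm]
  congr 1
  apply Finset.sum_congr rfl
  intro i _
  rw [prod_cast a b c hσ]
  simp only [CF_cast i hσ]
  by_cases hi : σ⁻¹ i < i
  · have h1 : ¬ i < σ i := fun h => hσ i ⟨hi, h⟩
    have h2 : σ i ≠ i := by
      intro h
      have : σ⁻¹ i = i := by rw [Equiv.Perm.inv_eq_iff_eq]; exact h.symm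
      rw [this] at hi
      exact lt_irrefl _ hi
    have h3 : labC a b c σ i = 1 := by
      unfold labC; rw [if_neg h2, if_neg h1, if_pos hi]
    rw [h3, if_neg (not_not.2 hi), Derivation.map_one_eq_zero, mul_zero]
  · rw [if_pos hi]
    congr 1
    unfold labC
    by_cases h1 : σ i = i
    · simp [h1, ha]
    · by_cases h2 : i < σ i
      · simp [h1, h2, hb]
      · rw [if_neg h2, if_neg h1, if_neg h2, if_neg hi, hc, mul_one]

lemma recC {R : Type*} [CommRing R] [Algebra ℝ R] (D : Derivation ℝ R R) (a b c : R)
    (ha : D a = b) (hb : D b = b * c) (hc : D c = b) (n : ℕ) :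
    (∑ σ ∈ univ.filter fun σ : Equiv.Perm (Fin (n + 1)) => IsSimsun2 σ,
        ∏ x, labC a b c σ x) =
      a * (∑ σ ∈ univ.filter fun σ : Equiv.Perm (Fin n) => IsSimsun2 σ, ∏ x, labC a b c σ x) +
      D (∑ σ ∈ univ.filter fun σ : Equiv.Perm (Fin n) => IsSimsun2 σ, ∏ x, labC a b c σ x) := by
  rw [Finset.sum_filter, ← (insC_bij n).sum_comp, Fintype.sum_prod_type_right, map_sum,
    Finset.mul_sum, ← Finset.sum_add_distrib, Finset.sum_filter]
  apply Finset.sum_congr rfl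
  intro σ _
  simp only [simsun_insC]
  split_ifs with h
  · rw [← recC1 D a b c ha hb hc (CF_of h)]
    simp [h]
  · simp [h]

lemma prodC {R : Type*} [CommRing R] (a b c : R) {n : ℕ} {σ : Equiv.Perm (Fin n)} (hσ : CF σ) :
    ∏ x, labC a b c σ x =
      a ^ fixStat σ * b ^ excStat σ * c ^ (n - fixStat σ - 2 * excStat σ) := by
  have hpk : (univ.filter fun x : Fin n => σ⁻¹ x < x).card = excStat σ := by
    unfold excStat
    symm
    apply Finset.card_bij (fun x _ => σ x)
    · intro x hx
      simpa using hx
    · intro x _ y _ h; exact σ.injective h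
    · intro y hy
      exact ⟨σ⁻¹ y, by simpa using hy, by simp⟩
  have htri : ∀ x, (σ x = x ∧ ¬ x < σ x ∧ ¬ σ⁻¹ x < x) ∨ (σ x ≠ x ∧ x < σ x ∧ ¬ σ⁻¹ x < x) ∨
      (σ x ≠ x ∧ ¬ x < σ x ∧ σ⁻¹ x < x) ∨ (σ x ≠ x ∧ ¬ x < σ x ∧ ¬ σ⁻¹ x < x) := by
    intro x
    have h1 := hσ x
    by_cases h : σ x = x
    · have : σ⁻¹ x = x := by rw [Equiv.Perm.inv_eq_iff_eq]; exact h.symm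
      left
      rw [this, h]; simp
    · tauto
  have hd : (univ.filter fun x : Fin n => σ x ≠ x ∧ ¬ x < σ x ∧ ¬ σ⁻¹ x < x).card =
      n - fixStat σ - 2 * excStat σ := by
    have : fixStat σ + excStat σ + (univ.filter fun x : Fin n => σ⁻¹ x < x).card +
        (univ.filter fun x : Fin n => σ x ≠ x ∧ ¬ x < σ x ∧ ¬ σ⁻¹ x < x).card = n := by
      unfold fixStat excStat
      simp only [Finset.card_filter]
      rw [← Finset.sum_add_distrib, ← Finset.sum_add_distrib, ← Finset.sum_add_distrib]
      trans ∑ i : Fin n, 1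
      · apply Finset.sum_congr rfl
        intro v _
        rcases htri v with ⟨h1, h2, h3⟩ | ⟨h1, h2, h3⟩ | ⟨h1, h2, h3⟩ | ⟨h1, h2, h3⟩ <;>
          simp only [h1, h2, h3, if_true, if_false] <;> simp [h1]
      · simp
    omega
  rw [← hd]
  unfold fixStat excStat
  simp only [← Finset.prod_const, Finset.prod_filter]
  rw [← Finset.prod_mul_distrib, ← Finset.prod_mul_distrib]
  apply Finset.prod_congr rfl
  intro v _
  unfold labC
  rcases htri v with ⟨h1, h2, h3⟩ | ⟨h1, h2, h3⟩ | ⟨h1, h2, h3⟩ | ⟨h1, h2, h3⟩ <;>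
    simp only [h1, h2, h3, if_true, if_false] <;> simp [h1]

lemma main_poly {R : Type*} [CommRing R] [Algebra ℝ R] (D : Derivation ℝ R R) (x y s t : R)
    (hx : D x = x * y) (hy : D y = x * y) (hs : D s = x * y) (ht : D t = x * y) (n : ℕ) :
    ∑ π : Equiv.Perm (Fin (n + 1)), ∏ v, labP x y s t π v =
      ∑ σ ∈ univ.filter fun σ : Equiv.Perm (Fin n) => IsSimsun2 σ,
        ∏ v, labC (s + t) (2 * x * y) (x + y) σ v := by
  induction n with
  | zero =>
    have : (univ.filter fun σ : Equiv.Perm (Fin 0) => IsSimsun2 σ) = univ := by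
      apply Finset.filter_true_of_mem
      intro σ _ m _ x
      exact x.elim0
    rw [this]
    simp
  | succ n ih =>
    have h2 : D (2 : R) = 0 := by
      have := D.map_natCast 2
      simpa using this
    rw [recP D x y s t hx hy hs ht, recC D (s + t) (2 * x * y) (x + y), ih]
    · rw [map_add, hs, ht]; ring
    · simp only [Derivation.leibniz, h2, hx, hy, smul_eq_mul]; ring
    · rw [map_add, hx, hy]; ring

/-- `Σ_{π ∈ S_{n+1}} x^basc y^(des-plrmin) s^suc t^plrmin
= Σ_{σ ∈ SS_n} (s+t)^fix (2xy)^exc (x+y)^(n - fix - 2 exc)`; in particular this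
polynomial is symmetric in `s, t` as well as in `x, y`. -/
theorem statement13 (n : ℕ) (x y s t : ℝ) :
    ∑ π : Equiv.Perm (Fin (n + 1)),
        x ^ basc π * y ^ (des π - plrmin π) * s ^ suc π * t ^ plrmin π =
      ∑ σ ∈ Finset.univ.filter fun σ : Equiv.Perm (Fin n) => IsSimsun2 σ,
        (s + t) ^ fixStat σ * (2 * x * y) ^ excStat σ *
          (x + y) ^ (n - fixStat σ - 2 * excStat σ) := by
  have h := main_poly (MvPolynomial.mkDerivation ℝ (fun _ : Fin 4 =>
      (MvPolynomial.X 0 * MvPolynomial.X 1 : MvPolynomial (Fin 4) ℝ)))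
    (MvPolynomial.X 0) (MvPolynomial.X 1) (MvPolynomial.X 2) (MvPolynomial.X 3)
    (MvPolynomial.mkDerivation_X _ _ _) (MvPolynomial.mkDerivation_X _ _ _)
    (MvPolynomial.mkDerivation_X _ _ _) (MvPolynomial.mkDerivation_X _ _ _) n
  have h2 := congrArg (MvPolynomial.aeval (R := ℝ) ![x, y, s, t]) h
  rw [Finset.sum_congr rfl fun π _ => prodP _ _ _ _ π,
    Finset.sum_congr rfl fun σ hσ => prodC _ _ _ (CF_of (Finset.mem_filter.1 hσ).2)] at h2
  simpa using h2

end SucEuler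
end

section
/- For every n ≥ 0 and all real numbers x, y, s, t: Σ_{π ∈ S_{n+1}} x^{basc(π)} y^{des(π)−plrmin(π)} s^{suc(π)} t^{plrmin(π)} = Σ_{σ ∈ S_n} x^{exc(σ)} y^{drop(σ)} (s+t)^{fix(σ)} 2^{cyc(σ)−fix(σ)}. -/
open Finset

namespace SucEuler

section Rhs

theorem cyc_sub {n : ℕ} (σ : Equiv.Perm (Fin n)) : cyc σ - fixStat σ = σ.cycleType.card := by
  simp [cyc]

theorem swap_card_cycleType {α : Type*} [Fintype α] [DecidableEq α] (f : Equiv.Perm α) (x : α)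
    (hx : f x ≠ x) :
    f.cycleType.card =
      (Equiv.swap x (f x) * f).cycleType.card + (if f (f x) = x then 1 else 0) := by
  set c := f.cycleOf x with hc
  have hcyc : c.IsCycle := Equiv.Perm.isCycle_cycleOf f hx
  have hmem : c ∈ f.cycleFactorsFinset :=
    Equiv.Perm.cycleOf_mem_cycleFactorsFinset_iff.2 (Equiv.Perm.mem_support.2 hx)
  have hdis := (Equiv.Perm.disjoint_mul_inv_of_mem_cycleFactorsFinset hmem).symm
  have hcomm := hdis.commute
  have hf : f = c * (f * c⁻¹) := by rw [hcomm.eq]; group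
  set g := f * c⁻¹ with hg
  have hcx : c x = f x := Equiv.Perm.cycleOf_apply_self f x
  have hccx : c (f x) = f (f x) := by
    have : f.SameCycle x (f x) := ⟨1, by simp⟩
    exact this.cycleOf_apply
  have h1 : f.cycleType.card = 1 + g.cycleType.card := by
    conv_lhs => rw [hf]
    rw [hdis.cycleType_mul, hcyc.cycleType]; simp; ring
  have hd2 : Equiv.Perm.Disjoint (Equiv.swap x (f x) * c) g := by
    rw [← hcx]
    rw [Equiv.Perm.disjoint_iff_disjoint_support] at hdis ⊢
    refine Finset.disjoint_of_subset_left ?_ hdis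
    intro z hz
    exact (Equiv.Perm.mem_support_swap_mul_imp_mem_support_ne hz).1
  have h2 : (Equiv.swap x (f x) * f).cycleType.card
      = (Equiv.swap x (f x) * c).cycleType.card + g.cycleType.card := by
    have : Equiv.swap x (f x) * f = (Equiv.swap x (f x) * c) * g := by
      rw [mul_assoc, ← hf]
    rw [this, hd2.cycleType_mul]; simp
  rw [h1, h2]
  by_cases h : f (f x) = x
  · have : Equiv.swap x (f x) * c = 1 := by
      have := hcyc.eq_swap_of_apply_apply_eq_self (x := x) (by rwa [hcx]) (by rw [hcx, hccx, h])
      rw [hcx] at this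
      rw [this]; simp
    rw [this, if_pos h]; simp; ring
  · have := hcyc.swap_mul (x := x) (by rwa [hcx]) (by rwa [hcx, hccx])
    rw [hcx] at this
    rw [this.cycleType, if_neg h]; simp

theorem hat_cycleType {n : ℕ} (e : Equiv.Perm (Fin n)) :
    (Equiv.Perm.decomposeFin.symm ((0 : Fin (n+1)), e)).cycleType = e.cycleType := by
  rw [← Equiv.Perm.cycleType_extendDomain (finSuccAboveEquiv (0 : Fin (n+1)))]
  congr 1
  ext i
  refine Fin.cases ?_ (fun j => ?_) i
  · rw [Equiv.Perm.extendDomain_apply_not_subtype]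
    · simp
    · simp
  · have := Equiv.Perm.extendDomain_apply_image e (finSuccAboveEquiv (0 : Fin (n+1))) j
    have h2 : ∀ j : Fin n, ((finSuccAboveEquiv (0 : Fin (n+1)) j : {x : Fin (n+1) // x ≠ 0}) : Fin (n+1)) = j.succ := fun j => by
      simp [finSuccAboveEquiv_apply]
    rw [h2, h2] at this
    rw [this]
    simp

theorem dec_eq {n : ℕ} (p : Fin (n+1)) (e : Equiv.Perm (Fin n)) :
    Equiv.Perm.decomposeFin.symm (p, e)
      = Equiv.swap 0 p * Equiv.Perm.decomposeFin.symm (0, e) := by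
  ext i
  refine Fin.cases ?_ (fun j => ?_) i <;> simp

theorem dec_card {n : ℕ} (e : Equiv.Perm (Fin n)) (a : Fin n) :
    (Equiv.Perm.decomposeFin.symm ((e a).succ, e)).cycleType.card
      = e.cycleType.card + if e a = a then 1 else 0 := by
  have h := swap_card_cycleType (Equiv.Perm.decomposeFin.symm ((e a).succ, e)) 0
    (by simp)
  rw [h]
  rw [Equiv.Perm.decomposeFin_symm_apply_zero]
  congr 1
  · rw [dec_eq (e a).succ, ← mul_assoc, Equiv.swap_mul_self, one_mul, hat_cycleType]
  · simp only [Equiv.Perm.decomposeFin_symm_apply_succ, Equiv.swap_apply_eq_iff]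
    simp

theorem dec_sum {n : ℕ} (e : Equiv.Perm (Fin n)) (a : Fin n) (P : ℕ → ℕ → Prop)
    [∀ a b, Decidable (P a b)] (hP : ∀ a b, P (a+1) (b+1) ↔ P a b) :
    (univ.filter fun i : Fin (n+1) =>
        P i (Equiv.Perm.decomposeFin.symm ((e a).succ, e) i : Fin (n+1))).card
      + (if P a (e a) then 1 else 0)
      = (univ.filter fun i : Fin n => P i (e i)).card
        + (if P 0 (e a + 1) then 1 else 0) + (if P (a+1) 0 then 1 else 0) := by
  rw [Finset.card_filter, Finset.card_filter, Fin.sum_univ_succ,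
    ← Finset.add_sum_erase univ _ (mem_univ a), ← Finset.add_sum_erase univ _ (mem_univ a)]
  have : ∀ i ∈ univ.erase a, (if P (i.succ : Fin (n+1)) (Equiv.Perm.decomposeFin.symm ((e a).succ, e) i.succ : Fin (n+1)) then 1 else 0) = if P i (e i) then 1 else 0 := by
    intro i hi
    have hi' : i ≠ a := (Finset.mem_erase.1 hi).1
    rw [Equiv.Perm.decomposeFin_symm_apply_succ, Equiv.swap_apply_of_ne_of_ne (by simp) (by simpa using hi')]
    simp [hP]
  rw [Finset.sum_congr rfl this]
  simp
  ring

theorem dec_sum0 {n : ℕ} (e : Equiv.Perm (Fin n)) (P : ℕ → ℕ → Prop)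
    [∀ a b, Decidable (P a b)] (hP : ∀ a b, P (a+1) (b+1) ↔ P a b) :
    (univ.filter fun i : Fin (n+1) =>
        P i (Equiv.Perm.decomposeFin.symm ((0 : Fin (n+1)), e) i : Fin (n+1))).card
      = (univ.filter fun i : Fin n => P i (e i)).card + (if P 0 0 then 1 else 0) := by
  rw [Finset.card_filter, Finset.card_filter, Fin.sum_univ_succ]
  simp [hP]
  ring

theorem exc_eq {n : ℕ} (e : Equiv.Perm (Fin n)) :
    excStat e = (univ.filter fun i : Fin n => (fun a b : ℕ => a < b) i (e i)).card := rfl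
theorem drop_eq {n : ℕ} (e : Equiv.Perm (Fin n)) :
    dropStat e = (univ.filter fun i : Fin n => (fun a b : ℕ => b < a) i (e i)).card := rfl
theorem fix_eq {n : ℕ} (e : Equiv.Perm (Fin n)) :
    fixStat e = (univ.filter fun i : Fin n => (fun a b : ℕ => b = a) i (e i)).card := by
  simp [fixStat, Fin.ext_iff]

variable {A : Type*} [CommRing A]

theorem D_pow1 (D : Derivation ℤ A A) (X Y : A) (h : D X = X * Y) (a : ℕ) :
    D (X ^ a) = a * X ^ a * Y := by
  cases a with
  | zero => simp
  | succ a => rw [Derivation.leibniz_pow, h]; simp; ring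

/-- the weight of a permutation on the right hand side -/
def wt (X Y U : A) {n : ℕ} (σ : Equiv.Perm (Fin n)) : A :=
  X ^ excStat σ * Y ^ dropStat σ * U ^ fixStat σ * 2 ^ (cyc σ - fixStat σ)

theorem rhs_step (D : Derivation ℤ A A) (X Y U : A) (hX : D X = X * Y) (hY : D Y = X * Y)
    (hU : D U = 2 * (X * Y)) (n : ℕ) :
    ∑ σ : Equiv.Perm (Fin (n+1)), wt X Y U σ
      = U * (∑ σ : Equiv.Perm (Fin n), wt X Y U σ) + D (∑ σ : Equiv.Perm (Fin n), wt X Y U σ) := by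
  rw [← Equiv.Perm.decomposeFin.symm.sum_comp, Fintype.sum_prod_type, Finset.sum_comm, map_sum,
    Finset.mul_sum, ← Finset.sum_add_distrib]
  refine Finset.sum_congr rfl fun e _ => ?_
  rw [Fin.sum_univ_succ, ← Equiv.sum_comp e (fun a => wt X Y U (Equiv.Perm.decomposeFin.symm (a.succ, e)))]
  congr 1
  · unfold wt
    have e1 := dec_sum0 e (fun a b : ℕ => a < b) (by simp)
    have e2 := dec_sum0 e (fun a b : ℕ => b < a) (by simp)
    have e3 := dec_sum0 e (fun a b : ℕ => b = a) (by simp)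
    rw [← exc_eq, ← exc_eq] at e1
    rw [← drop_eq, ← drop_eq] at e2
    rw [← fix_eq, ← fix_eq] at e3
    rw [cyc_sub, cyc_sub, hat_cycleType, e1, e2, e3]
    simp; ring
  · set a := excStat e with ha
    set b := dropStat e with hb
    set c := fixStat e with hc
    set k := e.cycleType.card with hk
    have key : ∀ i : Fin n, wt X Y U (Equiv.Perm.decomposeFin.symm ((e i).succ, e))
        = (if i < e i then 1 else 0) * (X ^ a * Y ^ (b+1) * U ^ c * 2 ^ k)
        + (if e i < i then 1 else 0) * (X ^ (a+1) * Y ^ b * U ^ c * 2 ^ k)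
        + (if e i = i then 1 else 0) * (X ^ (a+1) * Y ^ (b+1) * U ^ (c-1) * 2 ^ (k+1)) := by
      intro i
      have e1 := dec_sum e i (fun a b : ℕ => a < b) (by simp)
      have e2 := dec_sum e i (fun a b : ℕ => b < a) (by simp)
      have e3 := dec_sum e i (fun a b : ℕ => b = a) (by simp)
      have e4 := dec_card e i
      rw [← exc_eq, ← exc_eq] at e1
      rw [← drop_eq, ← drop_eq] at e2
      rw [← fix_eq, ← fix_eq] at e3
      unfold wt
      rw [cyc_sub, e4]
      simp only [← ha, ← hb, ← hc, ← hk] at e1 e2 e3 ⊢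
      simp only [Fin.lt_def, Fin.ext_iff] 
      rcases lt_trichotomy (i : ℕ) (e i : ℕ) with h | h | h
      · simp [h, h.ne', h.not_gt] at e1 e2 e3 ⊢
        rw [e1, e2, e3]
      · simp [← h] at e1 e2 e3 ⊢
        rw [e1, e2, ← e3]; simp
      · simp [h, h.ne, h.not_gt] at e1 e2 e3 ⊢
        rw [e1, e2, e3]
    rw [Finset.sum_congr rfl fun i _ => key i]
    simp only [Finset.sum_add_distrib, ← Finset.sum_mul]
    rw [Finset.sum_boole, Finset.sum_boole, Finset.sum_boole]
    change (a : A) * _ + (b : A) * _ + (c : A) * _ = _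
    unfold wt
    rw [cyc_sub, ← ha, ← hb, ← hc, ← hk]
    have h2 : D ((2 : A) ^ k) = 0 := by
      have := D.map_natCast (2 ^ k)
      simpa using this
    have hXa := D_pow1 D X Y hX a
    have hYb := D_pow1 D Y X (by rw [hY, mul_comm]) b
    simp only [Derivation.leibniz, h2, hXa, hYb, Derivation.leibniz_pow, hU, smul_eq_mul, nsmul_eq_mul]
    ring

end Rhs
section Lhs
open Classical

/-- indicator -/
noncomputable def ind (p : Prop) : ℕ := if p then 1 else 0

theorem ind_pos {p : Prop} (h : p) : ind p = 1 := if_pos h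
theorem ind_neg {p : Prop} (h : ¬ p) : ind p = 0 := if_neg h

/-- number of consecutive pairs satisfying `P` -/
noncomputable def cnt (P : ℕ → ℕ → Prop) (w : ℕ → ℕ) (N : ℕ) : ℕ :=
  ∑ i ∈ range N, ind (P (w (i+1)) (w (i+2)))

/-- insert `N+1` after position `k` -/
def insw (w : ℕ → ℕ) (k N : ℕ) (i : ℕ) : ℕ :=
  if i ≤ k then w i else if i = k + 1 then N + 1 else w (i - 1)

theorem cnt_ins (P : ℕ → ℕ → Prop) (w : ℕ → ℕ) (k N : ℕ) (hk : k < N) :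
    cnt P (insw w (k+1) N) (N+1) + ind (P (w (k+1)) (w (k+2)))
      = cnt P w N + ind (P (w (k+1)) (N+1)) + ind (P (N+1) (w (k+2))) := by
  obtain ⟨m, rfl⟩ : ∃ m, N = k + (1 + m) := ⟨N - k - 1, by omega⟩
  unfold cnt
  rw [show k + (1 + m) + 1 = k + (1 + (1 + m)) by omega]
  simp only [Finset.sum_range_add, Finset.sum_range_one]
  have h1 : ∀ i ∈ range k, ind (P (insw w (k+1) (k + (1 + m)) (i+1)) (insw w (k+1) (k + (1 + m)) (i+2)))
      = ind (P (w (i+1)) (w (i+2))) := by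
    intro i hi
    have := Finset.mem_range.1 hi
    simp only [insw]
    rw [if_pos (by omega), if_pos (by omega)]
  have h2 : ∀ i ∈ range m, ind (P (insw w (k+1) (k + (1 + m)) (k + (1 + (1 + i))+1)) (insw w (k+1) (k + (1 + m)) (k + (1 + (1 + i))+2)))
      = ind (P (w (k + (1 + i) + 1)) (w (k + (1 + i) + 2))) := by
    intro i hi
    simp only [insw]
    rw [if_neg (by omega), if_neg (by omega), if_neg (by omega), if_neg (by omega)]
    rw [show k + (1 + (1 + i)) + 1 - 1 = k + (1 + i) + 1 by omega, show k + (1 + (1 + i)) + 2 - 1 = k + (1 + i) + 2 by omega]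
  rw [Finset.sum_congr rfl h1, Finset.sum_congr rfl h2]
  have h3 : insw w (k+1) (k + (1 + m)) (k + 0 + 1) = w (k+1) := by simp [insw]
  have h4 : insw w (k+1) (k + (1 + m)) (k + 0 + 2) = k + (1 + (1 + m)) := by simp [insw]; ring
  have h5 : insw w (k+1) (k + (1 + m)) (k + (1 + 0) + 1) = k + (1 + (1 + m)) := by simp [insw]; ring
  have h6 : insw w (k+1) (k + (1 + m)) (k + (1 + 0) + 2) = w (k+2) := by simp [insw]
  rw [h3, h4, h6]
  simp only [Nat.add_zero]
  ring

theorem cnt_ins0 (P : ℕ → ℕ → Prop) (w : ℕ → ℕ) (N : ℕ) :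
    cnt P (insw w 0 N) (N+1) = cnt P w N + ind (P (N+1) (w 1)) := by
  unfold cnt
  rw [Finset.sum_range_succ']
  simp [insw]

structure Good (w : ℕ → ℕ) (N : ℕ) : Prop where
  pos : 1 ≤ N
  bd : ∀ i, 1 ≤ i → i ≤ N → 1 ≤ w i ∧ w i ≤ N
  out : ∀ i, N < i → w i = 0
  inj : ∀ i j, 1 ≤ i → i ≤ N → 1 ≤ j → j ≤ N → w i = w j → i = j
  surj : ∀ v, 1 ≤ v → v ≤ N → ∃ i, 1 ≤ i ∧ i ≤ N ∧ w i = v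

/-- the value `v` is a left-to-right minimum -/
def LM (w : ℕ → ℕ) (N v : ℕ) : Prop :=
  ∃ i, 1 ≤ i ∧ i ≤ N ∧ w i = v ∧ ∀ j, 1 ≤ j → j < i → v < w j

theorem LM_ins {w : ℕ → ℕ} {N : ℕ} (hw : Good w N) (k : ℕ) (hk : k < N) (v : ℕ) :
    LM (insw w (k+1) N) (N+1) v ↔ LM w N v := by
  constructor
  · rintro ⟨i, h1, h2, h3, h4⟩
    rcases lt_trichotomy i (k+2) with h | h | h
    · refine ⟨i, h1, by omega, ?_, fun j hj hji => ?_⟩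
      · rw [← h3, insw, if_pos (by omega)]
      · have := h4 j hj hji
        rwa [insw, if_pos (by omega)] at this
    · have := h4 1 (by omega) (by omega)
      have h5 := hw.bd 1 le_rfl hw.pos
      rw [insw, if_pos (by omega)] at this
      rw [insw, if_neg (by omega), if_pos h] at h3
      omega
    · refine ⟨i-1, by omega, by omega, ?_, fun j hj hji => ?_⟩
      · rw [← h3, insw, if_neg (by omega), if_neg (by omega)]
      · by_cases hjk : j ≤ k + 1
        · have := h4 j hj (by omega)
          rwa [insw, if_pos hjk] at this
        · have := h4 (j+1) (by omega) (by omega)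
          rwa [insw, if_neg (by omega), if_neg (by omega)] at this
  · rintro ⟨i, h1, h2, h3, h4⟩
    by_cases h : i ≤ k + 1
    · refine ⟨i, h1, by omega, ?_, fun j hj hji => ?_⟩
      · rw [insw, if_pos h, h3]
      · rw [insw, if_pos (by omega)]; exact h4 j hj hji
    · refine ⟨i+1, by omega, by omega, ?_, fun j hj hji => ?_⟩
      · rw [insw, if_neg (by omega), if_neg (by omega)]; exact h3
      · have hv := hw.bd i h1 h2
        unfold insw
        split_ifs with h6 h7
        · exact h4 j hj (by omega)
        · omega
        · exact h4 (j-1) (by omega) (by omega)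

theorem LM_ins0 {w : ℕ → ℕ} {N : ℕ} (hw : Good w N) (v : ℕ) :
    LM (insw w 0 N) (N+1) v ↔ LM w N v ∨ v = N + 1 := by
  constructor
  · rintro ⟨i, h1, h2, h3, h4⟩
    by_cases h : i = 1
    · right
      rw [← h3, insw, if_neg (by omega), if_pos (by omega)]
    · left
      refine ⟨i-1, by omega, by omega, ?_, fun j hj hji => ?_⟩
      · rw [← h3, insw, if_neg (by omega), if_neg (by omega)]
      · have := h4 (j+1) (by omega) (by omega)
        rwa [insw, if_neg (by omega), if_neg (by omega)] at this
  · rintro (⟨i, h1, h2, h3, h4⟩ | h)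
    · refine ⟨i+1, by omega, by omega, ?_, fun j hj hji => ?_⟩
      · rw [insw, if_neg (by omega), if_neg (by omega)]; exact h3
      · have hv := hw.bd i h1 h2
        unfold insw
        split_ifs with h6 h7
        · omega
        · omega
        · exact h4 (j-1) (by omega) (by omega)
    · exact ⟨1, le_rfl, by omega, by simp [insw, h], fun j _ _ => by omega⟩

theorem LM_le {w : ℕ → ℕ} {N : ℕ} (hw : Good w N) (v : ℕ) (h : LM w N v) : v ≤ N := by
  obtain ⟨i, h1, h2, h3, h4⟩ := h
  have := hw.bd i h1 h2
  omega

theorem cnt_max {w : ℕ → ℕ} {N : ℕ} (hw : Good w N) : cnt (fun a _ => a = N) w N = 1 := by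
  obtain ⟨i, h1, h2, h3⟩ := hw.surj N hw.pos le_rfl
  unfold cnt
  rw [Finset.sum_eq_single (i-1)]
  · apply ind_pos; rw [← h3]; congr 1; omega
  · intro j hj hji
    apply ind_neg
    intro h
    have := Finset.mem_range.1 hj
    have := hw.inj (j+1) i (by omega) (by omega) h1 h2 (by rw [h, h3])
    omega
  · intro h; exact absurd (Finset.mem_range.2 (by omega)) h

variable {A : Type*} [CommRing A]

/-- weight of a word -/
noncomputable def lw (X Y S T : A) (w : ℕ → ℕ) (N : ℕ) : A :=
  X ^ cnt (fun a b => a + 2 ≤ b) w N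
    * Y ^ (cnt (fun a b => b < a) w N - 1 - cnt (fun a b => b < a ∧ LM w N (a+1)) w N)
    * S ^ cnt (fun a b => b = a + 1) w N * T ^ cnt (fun a b => b < a ∧ LM w N (a+1)) w N

theorem cnt_congr {P Q : ℕ → ℕ → Prop} (w : ℕ → ℕ) (N : ℕ)
    (h : ∀ a b, P a b ↔ Q a b) : cnt P w N = cnt Q w N := by
  have : P = Q := by funext a b; exact propext (h a b)
  rw [this]

theorem lhs_step (D : Derivation ℤ A A) (X Y S T : A) (hX : D X = X * Y) (hY : D Y = X * Y)
    (hS : D S = X * Y) (hT : D T = X * Y) {w : ℕ → ℕ} {N : ℕ} (hw : Good w N) :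
    ∑ k ∈ range (N+1), lw X Y S T (insw w k N) (N+1)
      = (S + T) * lw X Y S T w N + D (lw X Y S T w N) := by
  set a := cnt (fun a b => a + 2 ≤ b) w N with ha
  set c := cnt (fun a b => b = a + 1) w N with hc
  set d := cnt (fun a b => b < a ∧ LM w N (a+1)) w N with hd
  set b := cnt (fun a b => b < a ∧ ¬ LM w N (a+1) ∧ a ≠ N) w N with hb
  have hdes : cnt (fun a b => b < a) w N = b + d + 1 := by
    rw [← cnt_max hw, hb, hd]
    unfold cnt
    rw [← Finset.sum_add_distrib, ← Finset.sum_add_distrib]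
    refine Finset.sum_congr rfl fun i hi => ?_
    have hi := Finset.mem_range.1 hi
    have h1 := hw.bd (i+1) (by omega) (by omega)
    have h2 : w (i+2) ≤ N ∧ w (i+2) ≠ w (i+1) := by
      by_cases h : i + 2 ≤ N
      · have := hw.bd (i+2) (by omega) h
        refine ⟨this.2, fun h' => ?_⟩
        have := hw.inj _ _ (by omega) h (by omega) (by omega) h'
        omega
      · rw [hw.out (i+2) (by omega)]; omega
    have h3 := LM_le hw (w (i+1) + 1)
    unfold ind
    by_cases hL : LM w N (w (i+1) + 1)
    · have := h3 hL
      simp [hL]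
      split_ifs <;> omega
    · simp [hL]
      split_ifs <;> omega
  have hl : lw X Y S T w N = X ^ a * Y ^ b * S ^ c * T ^ d := by
    unfold lw
    rw [← ha, ← hc, ← hd, hdes]
    congr 4
    omega
  rw [Finset.sum_range_succ', hl]
  have front : lw X Y S T (insw w 0 N) (N+1) = T * (X ^ a * Y ^ b * S ^ c * T ^ d) := by
    have hb1 := hw.bd 1 le_rfl hw.pos
    have hp : cnt (fun a b => b < a ∧ LM (insw w 0 N) (N+1) (a+1)) (insw w 0 N) (N+1) = d + 1 := by
      rw [cnt_congr (P := fun a b => b < a ∧ LM (insw w 0 N) (N+1) (a+1))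
        (Q := fun a b => b < a ∧ (LM w N (a+1) ∨ a + 1 = N + 1)) _ _ (fun a b => by rw [LM_ins0 hw]), cnt_ins0, ind_neg]
      · suffices cnt (fun a b => b < a ∧ (LM w N (a+1) ∨ a + 1 = N + 1)) w N
            = d + cnt (fun a _ => a = N) w N by rw [this, cnt_max hw]
        rw [hd]
        unfold cnt
        rw [← Finset.sum_add_distrib]
        refine Finset.sum_congr rfl fun i hi => ?_
        have hi := Finset.mem_range.1 hi
        have h1 := hw.bd (i+1) (by omega) (by omega)
        have h2 : w (i+2) ≤ N ∧ w (i+2) ≠ w (i+1) := by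
          by_cases h : i + 2 ≤ N
          · have := hw.bd (i+2) (by omega) h
            refine ⟨this.2, fun h' => ?_⟩
            have := hw.inj _ _ (by omega) h (by omega) (by omega) h'
            omega
          · rw [hw.out (i+2) (by omega)]; omega
        have h3 := LM_le hw (w (i+1) + 1)
        unfold ind
        by_cases hL : LM w N (w (i+1) + 1)
        · have := h3 hL
          simp [hL]
          omega
        · simp [hL]
          split_ifs <;> omega
      · rintro ⟨-, h | h⟩
        · have := LM_le hw _ h; omega
        · omega
    unfold lw
    rw [hp, cnt_ins0, cnt_ins0, cnt_ins0, hdes, ← ha, ← hc,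
      ind_neg (p := N + 1 + 2 ≤ w 1) (by omega), ind_neg (p := w 1 = N + 1 + 1) (by omega),
      ind_pos (p := w 1 < N + 1) (by omega)]
    rw [show b + d + 1 + 1 - 1 - (d+1) = b by omega]
    ring
  rw [front]
  have key : ∀ k ∈ range N, lw X Y S T (insw w (k+1) N) (N+1)
      = (ind (w (k+1) = N) : A) * (X ^ a * Y ^ b * S ^ (c+1) * T ^ d)
      + (ind (w (k+1) + 2 ≤ w (k+2)) : A) * (X ^ a * Y ^ (b+1) * S ^ c * T ^ d)
      + (ind (w (k+2) < w (k+1) ∧ ¬ LM w N (w (k+1) + 1) ∧ w (k+1) ≠ N) : A)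
          * (X ^ (a+1) * Y ^ b * S ^ c * T ^ d)
      + (ind (w (k+2) = w (k+1) + 1) : A) * (X ^ (a+1) * Y ^ (b+1) * S ^ (c-1) * T ^ d)
      + (ind (w (k+2) < w (k+1) ∧ LM w N (w (k+1) + 1)) : A)
          * (X ^ (a+1) * Y ^ (b+1) * S ^ c * T ^ (d-1)) := by
    intro k hk
    have hk := Finset.mem_range.1 hk
    have h1 := hw.bd (k+1) (by omega) (by omega)
    have h2 : w (k+2) ≤ N ∧ w (k+2) ≠ w (k+1) := by
      by_cases h : k + 2 ≤ N
      · have := hw.bd (k+2) (by omega) h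
        refine ⟨this.2, fun h' => ?_⟩
        have := hw.inj _ _ (by omega) h (by omega) (by omega) h'
        omega
      · rw [hw.out (k+2) (by omega)]; omega
    have h3 := LM_le hw (w (k+1) + 1)
    have h4 : ¬ LM w N (N + 1 + 1) := fun h => by have := LM_le hw _ h; omega
    have e1 := cnt_ins (fun a b => a + 2 ≤ b) w k N hk
    have e2 := cnt_ins (fun a b => b < a) w k N hk
    have e3 := cnt_ins (fun a b => b = a + 1) w k N hk
    have e4 := cnt_ins (fun a b => b < a ∧ LM w N (a+1)) w k N hk
    unfold lw
    rw [cnt_congr (P := fun a b => b < a ∧ LM (insw w (k+1) N) (N+1) (a+1))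
      (Q := fun a b => b < a ∧ LM w N (a+1)) _ _ (fun a b => by rw [LM_ins hw k hk])]
    rw [← ha] at e1
    rw [hdes] at e2
    rw [← hc] at e3
    rw [← hd] at e4
    generalize cnt (fun a b => a + 2 ≤ b) (insw w (k+1) N) (N+1) = a' at *
    generalize cnt (fun a b => b < a) (insw w (k+1) N) (N+1) = b' at *
    generalize cnt (fun a b => b = a + 1) (insw w (k+1) N) (N+1) = c' at *
    generalize cnt (fun a b => b < a ∧ LM w N (a+1)) (insw w (k+1) N) (N+1) = d' at *
    clear_value a b c d
    simp only [h4, and_false] at e4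
    generalize w (k+1) = u at *
    generalize w (k+2) = v at *
    rw [ind_neg (p := N + 1 + 2 ≤ v) (by omega)] at e1
    rw [ind_neg (p := N + 1 < u) (by omega), ind_pos (p := v < N + 1) (by omega)] at e2
    rw [ind_neg (p := v = N + 1 + 1) (by omega)] at e3
    rw [ind_neg (p := False) (by simp), ind_neg (p := N + 1 < u ∧ LM w N (u + 1)) (by omega)] at e4
    by_cases c1 : u = N
    · have hL : ¬ LM w N (u+1) := fun h => by have := h3 h; omega
      rw [ind_neg (by omega), ind_neg (by omega)] at e1
      rw [ind_pos (by omega)] at e2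
      rw [ind_neg (by omega), ind_pos (by omega)] at e3
      rw [ind_neg (by simp [hL])] at e4
      rw [ind_pos c1, ind_neg (by omega), ind_neg (by simp [c1]), ind_neg (by omega), ind_neg (by simp [hL])]
      obtain rfl : a' = a := by omega
      obtain rfl : c' = c + 1 := by omega
      obtain rfl : d' = d := by omega
      rw [show b' - 1 - d' = b by omega]
      simp
    rw [ind_pos (p := u + 2 ≤ N + 1) (by omega)] at e1
    rw [ind_neg (p := N + 1 = u + 1) (by omega)] at e3
    rw [ind_neg c1]
    by_cases c2 : u + 2 ≤ v
    · rw [ind_pos c2] at e1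
      rw [ind_neg (by omega)] at e2
      rw [ind_neg (by omega)] at e3
      rw [ind_neg (by omega)] at e4
      rw [ind_pos c2, ind_neg (by omega), ind_neg (by omega), ind_neg (by omega)]
      obtain rfl : a' = a := by omega
      obtain rfl : c' = c := by omega
      obtain rfl : d' = d := by omega
      rw [show b' - 1 - d' = b + 1 by omega]
      simp
    rw [ind_neg c2] at e1 ⊢
    obtain rfl : a' = a + 1 := by omega
    by_cases c3 : v = u + 1
    · rw [ind_neg (by omega)] at e2
      rw [ind_pos c3] at e3
      rw [ind_neg (by omega)] at e4
      rw [ind_pos c3, ind_neg (by omega), ind_neg (by omega)]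
      obtain rfl : c' = c - 1 := by omega
      obtain rfl : d' = d := by omega
      rw [show b' - 1 - d' = b + 1 by omega]
      simp
    rw [ind_neg c3] at e3 ⊢
    have c4 : v < u := by omega
    rw [ind_pos c4] at e2
    obtain rfl : c' = c := by omega
    by_cases hL : LM w N (u+1)
    · rw [ind_pos ⟨c4, hL⟩] at e4
      rw [ind_neg (by simp [hL]), ind_pos ⟨c4, hL⟩]
      obtain rfl : d' = d - 1 := by omega
      rw [show b' - 1 - (d - 1) = b + 1 by omega]
      simp
    · rw [ind_neg (by simp [hL])] at e4
      rw [ind_pos ⟨c4, hL, c1⟩, ind_neg (by simp [hL])]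
      obtain rfl : d' = d := by omega
      rw [show b' - 1 - d' = b by omega]
      simp
  rw [Finset.sum_congr rfl key]
  simp only [Finset.sum_add_distrib, ← Finset.sum_mul, ← Nat.cast_sum]
  change ((cnt (fun a _ => a = N) w N : ℕ) : A) * _ + (a : A) * _ + (b : A) * _ + (c : A) * _ + (d : A) * _ + _ = _
  rw [cnt_max hw]
  have hXa := D_pow1 D X Y hX a
  have hYb := D_pow1 D Y X (by rw [hY, mul_comm]) b
  simp only [Derivation.leibniz, hXa, hYb, Derivation.leibniz_pow, hS, hT, smul_eq_mul, nsmul_eq_mul]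
  push_cast
  ring

end Lhs
section Bridge

theorem word_in {n : ℕ} (π : Equiv.Perm (Fin n)) (i : ℕ) (h : i < n) :
    word π (i+1) = (π ⟨i, h⟩ : ℕ) + 1 := by
  unfold word
  rw [dif_pos (by omega)]
  simp

theorem word_good {n : ℕ} (π : Equiv.Perm (Fin (n+1))) : Good (word π) (n+1) where
  pos := by omega
  bd i h1 h2 := by
    obtain ⟨i, rfl⟩ : ∃ j, i = j + 1 := ⟨i - 1, by omega⟩
    rw [word_in π i (by omega)]
    have := (π ⟨i, by omega⟩).2
    omega
  out i h := by
    unfold word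
    rw [dif_neg (by omega)]
  inj i j h1 h2 h3 h4 h := by
    obtain ⟨i, rfl⟩ : ∃ j, i = j + 1 := ⟨i - 1, by omega⟩
    obtain ⟨j, rfl⟩ : ∃ i, j = i + 1 := ⟨j - 1, by omega⟩
    rw [word_in π i (by omega), word_in π j (by omega)] at h
    have := π.injective (Fin.ext (Nat.succ_injective h))
    simp at this
    omega
  surj v h1 h2 := by
    refine ⟨(π.symm ⟨v - 1, by omega⟩ : ℕ) + 1, by omega, by have := (π.symm ⟨v - 1, by omega⟩).2; omega, ?_⟩
    rw [word_in π _ (π.symm ⟨v - 1, by omega⟩).2]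
    simp
    omega

/-- insert the maximal value at (0-indexed) position `p` -/
def insPerm {n : ℕ} (p : Fin (n+1)) (π : Equiv.Perm (Fin n)) : Equiv.Perm (Fin (n+1)) :=
  ((finSuccEquiv' p).trans (Equiv.optionCongr π)).trans finSuccEquivLast.symm

theorem insPerm_self {n : ℕ} (p : Fin (n+1)) (π : Equiv.Perm (Fin n)) :
    insPerm p π p = Fin.last n := by
  simp [insPerm]

theorem insPerm_succAbove {n : ℕ} (p : Fin (n+1)) (π : Equiv.Perm (Fin n)) (j : Fin n) :
    insPerm p π (p.succAbove j) = (π j).castSucc := by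
  simp [insPerm]

theorem insPerm_bij (n : ℕ) : Function.Bijective
    (fun q : Fin (n+1) × Equiv.Perm (Fin n) => insPerm q.1 q.2) := by
  rw [Fintype.bijective_iff_injective_and_card]
  constructor
  · rintro ⟨p, π⟩ ⟨p', π'⟩ h
    simp only at h
    have hp : p = p' := by
      have h1 := insPerm_self p π
      rw [h, ← insPerm_self p' π'] at h1
      exact (insPerm p' π').injective h1
    subst hp
    congr 1
    ext j
    have h1 := insPerm_succAbove p π j
    rw [h, insPerm_succAbove] at h1
    have := Fin.castSucc_injective _ h1
    rw [this]
  · simp [Fintype.card_perm, Nat.factorial_succ]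

theorem word_insPerm {n : ℕ} (p : Fin (n+1)) (π : Equiv.Perm (Fin n)) :
    word (insPerm p π) = insw (word π) p n := by
  funext i
  unfold insw
  rcases Nat.eq_zero_or_pos i with h0 | h0
  · subst h0; simp [word]
  obtain ⟨i, rfl⟩ : ∃ j, i = j + 1 := ⟨i - 1, by omega⟩
  have hp := p.2
  by_cases hi : i < n + 1
  · rw [word_in _ i hi]
    split_ifs with h1 h2
    · have : (⟨i, hi⟩ : Fin (n+1)) = p.succAbove ⟨i, by omega⟩ := by
        rw [Fin.succAbove_of_castSucc_lt]
        · rfl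
        · simp [Fin.lt_def]; omega
      rw [this, insPerm_succAbove, word_in π i (by omega)]
      simp
    · have : (⟨i, hi⟩ : Fin (n+1)) = p := Fin.ext (by simpa using h2)
      rw [this, insPerm_self]
      simp
    · obtain ⟨j, rfl⟩ : ∃ j, i = j + 1 := ⟨i - 1, by omega⟩
      have : (⟨j+1, hi⟩ : Fin (n+1)) = p.succAbove ⟨j, by omega⟩ := by
        rw [Fin.succAbove_of_le_castSucc]
        · rfl
        · simp [Fin.le_def]; omega
      rw [this, insPerm_succAbove]
      simp only [Nat.add_sub_cancel]
      rw [word_in π j (by omega)]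
      simp
  · rw [if_neg (by omega), if_neg (by omega)]
    unfold word
    rw [dif_neg (by omega), dif_neg (by omega)]

theorem card_eq_cnt (P : ℕ → ℕ → Prop) [∀ a b, Decidable (P a b)] (w : ℕ → ℕ) (N : ℕ) :
    ((Finset.Icc 1 N).filter fun i => P (w i) (w (i+1))).card = cnt P w N := by
  rw [Finset.card_filter]
  unfold cnt ind
  rw [← Finset.Ico_add_one_right_eq_Icc, Finset.sum_Ico_eq_sum_range]
  refine Finset.sum_congr (by simp) fun i _ => ?_
  rw [show 1 + i = i + 1 by omega]
  congr

theorem cnt_last (P : ℕ → ℕ → Prop) {n : ℕ} (π : Equiv.Perm (Fin (n+1))) :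
    cnt P (word π) (n+1) = cnt P (word π) n + ind (P (word π (n+1)) 0) := by
  unfold cnt
  rw [Finset.sum_range_succ, (word_good π).out (n+2) (by omega)]

theorem des_cnt {n : ℕ} (π : Equiv.Perm (Fin (n+1))) :
    cnt (fun a b => b < a) (word π) (n+1) = des π + 1 := by
  have h := (word_good π).bd (n+1) (by omega) le_rfl
  rw [cnt_last, ind_pos (by omega), ← card_eq_cnt]
  rfl

theorem suc_cnt {n : ℕ} (π : Equiv.Perm (Fin (n+1))) :
    cnt (fun a b => b = a + 1) (word π) (n+1) = suc π := by
  rw [cnt_last, ind_neg (by omega), ← card_eq_cnt]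
  rfl

theorem basc_cnt {n : ℕ} (π : Equiv.Perm (Fin (n+1))) :
    cnt (fun a b => a + 2 ≤ b) (word π) (n+1) = basc π := by
  rw [cnt_last, ind_neg (by omega), ← card_eq_cnt]
  rfl

open Classical in
theorem plrmin_cnt {n : ℕ} (π : Equiv.Perm (Fin (n+1))) :
    cnt (fun a b => b < a ∧ LM (word π) (n+1) (a+1)) (word π) (n+1) = plrmin π := by
  have hw := word_good π
  rw [← card_eq_cnt]
  unfold plrmin
  symm
  set w := word π
  have hex : ∀ i, ∃ k, (1 ≤ i → i ≤ n + 1 → w i ≠ 1 → 1 ≤ k ∧ k ≤ n + 1 ∧ w k = w i - 1) := by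
    intro i
    by_cases h : 1 ≤ i ∧ i ≤ n + 1 ∧ w i ≠ 1
    · have := hw.bd i h.1 h.2.1
      obtain ⟨k, hk⟩ := hw.surj (w i - 1) (by omega) (by omega)
      exact ⟨k, fun _ _ _ => hk⟩
    · exact ⟨0, fun h1 h2 h3 => absurd ⟨h1, h2, h3⟩ h⟩
  choose f hf using hex
  refine Finset.card_bij (fun i _ => f i) ?_ ?_ ?_
  · intro i hi
    simp only [Finset.mem_filter, Finset.mem_Icc] at hi ⊢
    obtain ⟨⟨h1, h2⟩, h3, h4, k, hk, hik, h5, h6⟩ := hi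
    obtain ⟨g1, g2, g3⟩ := hf i h1 h2 h4
    have hb := hw.bd i h1 h2
    have : f i = k := hw.inj _ _ g1 g2 hk.1 hk.2 (by rw [g3, h5])
    rw [this]
    refine ⟨hk, h6, i, h1, h2, by omega, fun j hj hji => ?_⟩
    have := h3 j ⟨hj, by omega⟩ hji
    omega
  · intro i hi j hj h
    simp only [Finset.mem_filter, Finset.mem_Icc] at hi hj
    obtain ⟨g1, g2, g3⟩ := hf i hi.1.1 hi.1.2 hi.2.2.1
    obtain ⟨k1, k2, k3⟩ := hf j hj.1.1 hj.1.2 hj.2.2.1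
    have h1 := hw.bd i hi.1.1 hi.1.2
    have h2 := hw.bd j hj.1.1 hj.1.2
    rw [h, k3] at g3
    exact hw.inj i j hi.1.1 hi.1.2 hj.1.1 hj.1.2 (by omega)
  · intro k hk
    simp only [Finset.mem_filter, Finset.mem_Icc] at hk
    obtain ⟨⟨h1, h2⟩, h3, i, i1, i2, i3, i4⟩ := hk
    have hb := hw.bd k h1 h2
    obtain ⟨g1, g2, g3⟩ := hf i i1 i2 (by omega)
    have hfk : f i = k := hw.inj _ _ g1 g2 h1 h2 (by omega)
    refine ⟨i, ?_, hfk⟩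
    simp only [Finset.mem_filter, Finset.mem_Icc]
    refine ⟨⟨i1, i2⟩, fun j hj hji => by rw [i3]; exact i4 j hj.1 hji, by omega, k, ⟨h1, h2⟩, ?_, by omega, h3⟩
    rcases lt_trichotomy i k with h | h | h
    · exact h
    · subst h; omega
    · have := i4 k h1 h; omega

variable {A : Type*} [CommRing A]

theorem lw_word (X Y S T : A) {n : ℕ} (π : Equiv.Perm (Fin (n+1))) :
    lw X Y S T (word π) (n+1)
      = X ^ basc π * Y ^ (des π - plrmin π) * S ^ suc π * T ^ plrmin π := by
  unfold lw
  rw [basc_cnt, des_cnt, plrmin_cnt, suc_cnt]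
  rfl

theorem lhs_sum_step (D : Derivation ℤ A A) (X Y S T : A) (hX : D X = X * Y) (hY : D Y = X * Y)
    (hS : D S = X * Y) (hT : D T = X * Y) (n : ℕ) :
    ∑ π : Equiv.Perm (Fin (n+2)), lw X Y S T (word π) (n+2)
      = (S + T) * (∑ π : Equiv.Perm (Fin (n+1)), lw X Y S T (word π) (n+1))
        + D (∑ π : Equiv.Perm (Fin (n+1)), lw X Y S T (word π) (n+1)) := by
  rw [← (insPerm_bij (n+1)).sum_comp, Fintype.sum_prod_type, Finset.sum_comm, map_sum,
    Finset.mul_sum, ← Finset.sum_add_distrib]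
  refine Finset.sum_congr rfl fun π _ => ?_
  rw [← lhs_step D X Y S T hX hY hS hT (word_good π), Finset.sum_range]
  refine Finset.sum_congr rfl fun p _ => ?_
  simp only [word_insPerm]

theorem main_eq (D : Derivation ℤ A A) (X Y S T : A) (hX : D X = X * Y) (hY : D Y = X * Y)
    (hS : D S = X * Y) (hT : D T = X * Y) (n : ℕ) :
    ∑ π : Equiv.Perm (Fin (n+1)), lw X Y S T (word π) (n+1)
      = ∑ σ : Equiv.Perm (Fin n), wt X Y (S+T) σ := by
  induction n with
  | zero =>
    have h2 : plrmin (1 : Equiv.Perm (Fin (0+1))) = 0 := by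
      unfold plrmin
      rw [Finset.card_eq_zero]
      refine Finset.eq_empty_of_forall_notMem fun i hi => ?_
      simp only [Finset.mem_filter] at hi
      obtain ⟨hi, -, h, -⟩ := hi
      have := (word_good (1 : Equiv.Perm (Fin (0+1)))).bd i (Finset.mem_Icc.1 hi).1 (Finset.mem_Icc.1 hi).2
      omega
    have hs : Subsingleton (Equiv.Perm (Fin (0+1))) := inferInstanceAs (Subsingleton (Equiv.Perm (Fin 1)))
    rw [Fintype.sum_subsingleton _ (1 : Equiv.Perm (Fin (0+1))),
      Fintype.sum_subsingleton _ (1 : Equiv.Perm (Fin 0)), lw_word, h2]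
    simp [wt, basc, des, suc, excStat, dropStat, fixStat, cyc]
  | succ n ih =>
    rw [lhs_sum_step D X Y S T hX hY hS hT, ih,
      rhs_step D X Y (S+T) hX hY (by rw [map_add, hS, hT]; ring)]

end Bridge

/-- `Σ_{π ∈ S_{n+1}} x^basc y^(des-plrmin) s^suc t^plrmin
= Σ_{σ ∈ S_n} x^exc y^drop (s+t)^fix 2^(cyc-fix)`. -/
theorem statement14 (n : ℕ) (x y s t : ℝ) :
    ∑ π : Equiv.Perm (Fin (n + 1)),
        x ^ basc π * y ^ (des π - plrmin π) * s ^ suc π * t ^ plrmin π =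
      ∑ σ : Equiv.Perm (Fin n),
        x ^ excStat σ * y ^ dropStat σ * (s + t) ^ fixStat σ *
          (2 : ℝ) ^ (cyc σ - fixStat σ) := by
  let m : Fin 4 → MvPolynomial (Fin 4) ℤ := fun _ => MvPolynomial.X 0 * MvPolynomial.X 1
  have h := main_eq (MvPolynomial.mkDerivation ℤ m) (MvPolynomial.X 0) (MvPolynomial.X 1)
    (MvPolynomial.X 2) (MvPolynomial.X 3) (MvPolynomial.mkDerivation_X ..)
    (MvPolynomial.mkDerivation_X ..) (MvPolynomial.mkDerivation_X ..)
    (MvPolynomial.mkDerivation_X ..) n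
  have h2 := congrArg (MvPolynomial.aeval (![x, y, s, t] : Fin 4 → ℝ)) h
  simpa [lw_word, wt] using h2

end SucEuler
end

section
/- For every n ≥ 0 and every real number s: Σ_{π ∈ S_{n+1}} s^{simsuc(π)} = Σ_{σ ∈ S_n} (1+s)^{cyc(σ)} = (1+s)(2+s)⋯(n+s) = Σ_{k=0}^{n} c(n,k) (s+1)^k, where c(n,k) = #{σ ∈ S_n : cyc(σ)=k} is the unsigned Stirling number of the first kind. -/
open Finset

namespace SucEuler

/-! simsun part -/

def Pst {n : ℕ} (τ : Equiv.Perm (Fin n)) (v : Fin n) : Prop :=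
  ∃ u : Fin n, u.val = v.val + 1 ∧ τ v < τ u ∧ ∀ w, τ v < τ w → τ w < τ u → u < w

open Classical in
noncomputable def Sst {n : ℕ} (τ : Equiv.Perm (Fin n)) : ℕ :=
  ∑ v : Fin n, if Pst τ v then 1 else 0

lemma word_succ {n : ℕ} (π : Equiv.Perm (Fin n)) (a : Fin n) :
    word π (a.val + 1) = (π a).val + 1 := by
  have := a.isLt
  simp [word]

lemma simsuc_eq {n : ℕ} (π : Equiv.Perm (Fin n)) : simsuc π = Sst π⁻¹ := by
  classical
  have hap : ∀ x, π (π⁻¹ x) = x := fun x => π.apply_symm_apply x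
  have hinv : ∀ x, π⁻¹ (π x) = x := fun x => π.symm_apply_apply x
  unfold simsuc Sst
  rw [← Finset.card_filter]
  symm
  refine Finset.card_bij (fun v _ => (π⁻¹ v).val + 1) ?_ ?_ ?_
  · intro v hv
    replace hv : Pst π⁻¹ v := (Finset.mem_filter.1 hv).2
    obtain ⟨u, hu, hlt, hw⟩ := hv
    simp only [Finset.mem_filter, Finset.mem_Icc]
    refine ⟨by omega, (π⁻¹ u).val + 1, by omega, by simpa using hlt, ?_, ?_⟩
    · rw [word_succ, word_succ]; simp [hu]
    · intro k hk h1 h2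
      obtain ⟨k, rfl⟩ : ∃ k', k = k' + 1 := ⟨k - 1, by omega⟩
      have := hw (π ⟨k, by omega⟩) (by rw [hinv, Fin.lt_def]; simp only; omega)
        (by rw [hinv, Fin.lt_def]; simp only; omega)
      have e := word_succ π ⟨k, by omega⟩
      simp only at e
      rw [word_succ, e]
      simp only [hap]
      rw [Fin.lt_def] at this
      omega
  · intro a _ b _ h
    have : π⁻¹ a = π⁻¹ b := Fin.ext (by simpa using h)
    exact π⁻¹.injective this
  · intro i hi
    simp only [Finset.mem_filter, Finset.mem_Icc] at hi
    obtain ⟨hi, j, hj, hij, hw, hk⟩ := hi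
    obtain ⟨i, rfl⟩ : ∃ k', i = k' + 1 := ⟨i - 1, by omega⟩
    obtain ⟨j, rfl⟩ : ∃ k', j = k' + 1 := ⟨j - 1, by omega⟩
    have ei := word_succ π ⟨i, by omega⟩
    have ej := word_succ π ⟨j, by omega⟩
    simp only at ei ej
    refine ⟨π ⟨i, by omega⟩, ?_, by simp⟩
    refine Finset.mem_filter.2 ⟨Finset.mem_univ _, ?_⟩
    refine ⟨π ⟨j, by omega⟩, by omega, by simpa using hij, ?_⟩
    intro w h1 h2
    have := hk ((π⁻¹ w).val + 1) (by omega) (by simpa [Fin.lt_def] using h1)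
      (by simpa [Fin.lt_def] using h2)
    rw [word_succ] at this
    simp only [hap] at this
    rw [Fin.lt_def]; omega

def Ins {n : ℕ} (p : Fin (n + 1)) (τ : Equiv.Perm (Fin n)) : Equiv.Perm (Fin (n + 1)) :=
  ((finSuccEquiv' (Fin.last n)).trans (Equiv.optionCongr τ)).trans (finSuccEquiv' p).symm

lemma Ins_last {n : ℕ} (p : Fin (n + 1)) (τ : Equiv.Perm (Fin n)) :
    Ins p τ (Fin.last n) = p := by
  simp [Ins]

lemma Ins_castSucc {n : ℕ} (p : Fin (n + 1)) (τ : Equiv.Perm (Fin n)) (v : Fin n) :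
    Ins p τ v.castSucc = p.succAbove (τ v) := by
  have : v.castSucc = (Fin.last n).succAbove v := by simp
  rw [this]
  simp only [Ins, Equiv.trans_apply, finSuccEquiv'_succAbove]
  simp

lemma Ins_bij (n : ℕ) : Function.Bijective
    (fun x : Fin (n + 1) × Equiv.Perm (Fin n) => Ins x.1 x.2) := by
  rw [Fintype.bijective_iff_injective_and_card]
  constructor
  · rintro ⟨p, τ⟩ ⟨q, ρ⟩ h
    simp only at h
    have h1 : p = q := by rw [← Ins_last p τ, h, Ins_last]
    subst h1
    congr 1
    ext v
    have : Ins p τ v.castSucc = Ins p ρ v.castSucc := by rw [h]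
    rw [Ins_castSucc, Ins_castSucc] at this
    rw [Fin.succAbove_right_injective this]
  · simp [Fintype.card_perm, Nat.factorial_succ]

lemma Pst_last {n : ℕ} (τ : Equiv.Perm (Fin (n + 1))) : ¬ Pst τ (Fin.last n) := by
  rintro ⟨u, hu, -⟩
  have := u.isLt
  simp at hu; omega

lemma Pst_castSucc {n : ℕ} (τ : Equiv.Perm (Fin (n + 1))) (v : Fin n) :
    Pst τ v.castSucc ↔ τ v.castSucc < τ v.succ ∧
      ∀ w, τ v.castSucc < τ w → τ w < τ v.succ → v.succ < w := by
  constructor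
  · rintro ⟨u, hu, h⟩
    have : u = v.succ := Fin.ext (by simpa using hu)
    subst this; exact h
  · intro h; exact ⟨v.succ, by simp, h⟩

lemma Pst_Ins {n : ℕ} (p : Fin (n + 2)) (τ : Equiv.Perm (Fin (n + 1))) (v : Fin n) :
    Pst (Ins p τ) v.castSucc.castSucc ↔ Pst τ v.castSucc := by
  rw [Pst_castSucc, Pst_castSucc, Fin.succ_castSucc, Ins_castSucc, Ins_castSucc]
  simp only [Fin.succAbove_lt_succAbove_iff]
  refine and_congr_right fun _ => ?_
  rw [Fin.forall_fin_succ']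
  simp only [Ins_castSucc, Fin.succAbove_lt_succAbove_iff, Fin.castSucc_lt_castSucc_iff,
    Fin.castSucc_lt_last, implies_true, and_true]

lemma Pst_Ins_last {n : ℕ} (p : Fin (n + 2)) (τ : Equiv.Perm (Fin (n + 1))) :
    Pst (Ins p τ) (Fin.last n).castSucc ↔ p = (τ (Fin.last n)).succ := by
  rw [Pst_castSucc, Fin.succ_last, Ins_last, Ins_castSucc]
  constructor
  · rintro ⟨h1, h2⟩
    by_contra hne
    rw [Fin.succAbove_lt_iff_castSucc_lt] at h1
    rw [Fin.succAbove_of_castSucc_lt _ _ h1] at h2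
    have hlt : (τ (Fin.last n)).succ < p := by
      rw [Fin.lt_def] at h1 ⊢
      rw [Fin.ext_iff] at hne
      simp at h1 hne ⊢; omega
    obtain ⟨w, hw⟩ := (Ins p τ).surjective (τ (Fin.last n)).succ
    have := h2 w (by rw [hw]; exact Fin.castSucc_lt_succ) (by rw [hw]; exact hlt)
    exact absurd this (not_lt.2 (Fin.le_last w))
  · rintro rfl
    rw [Fin.succAbove_of_castSucc_lt _ _ Fin.castSucc_lt_succ]
    refine ⟨Fin.castSucc_lt_succ, fun w h1 h2 => ?_⟩
    rw [Fin.lt_def] at h1 h2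
    simp at h1 h2; omega

open Classical in
lemma Sst_Ins {n : ℕ} (p : Fin (n + 2)) (τ : Equiv.Perm (Fin (n + 1))) :
    Sst (Ins p τ) = Sst τ + if p = (τ (Fin.last n)).succ then 1 else 0 := by
  unfold Sst
  rw [Fin.sum_univ_castSucc, Fin.sum_univ_castSucc, Fin.sum_univ_castSucc]
  simp only [Pst_Ins, Pst_Ins_last, Pst_last, if_false, add_zero]

lemma sum_Sst (n : ℕ) (s : ℝ) : ∑ τ : Equiv.Perm (Fin (n + 1)), s ^ Sst τ =
    ∏ i ∈ Finset.range n, ((i : ℝ) + 1 + s) := by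
  classical
  induction n with
  | zero =>
    have h : ∀ τ : Equiv.Perm (Fin 1), Sst τ = 0 := by
      intro τ
      have := Pst_last τ
      simp only [Sst, Fin.sum_univ_castSucc]
      simpa using this
    simp [h]
  | succ n ih =>
    rw [Finset.prod_range_succ, ← ih, ← (Ins_bij (n + 1)).sum_comp, Fintype.sum_prod_type_right,
      Finset.sum_mul]
    refine Finset.sum_congr rfl fun τ _ => ?_
    simp only [Sst_Ins, pow_add, ← Finset.mul_sum]
    congr 1
    rw [← Finset.add_sum_erase _ _ (Finset.mem_univ (τ (Fin.last n)).succ)]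
    rw [Finset.sum_congr rfl (g := fun _ => (1 : ℝ))]
    · simp; ring
    · intro x hx
      simp [Finset.ne_of_mem_erase hx]

lemma sum_simsuc (n : ℕ) (s : ℝ) : ∑ π : Equiv.Perm (Fin (n + 1)), s ^ simsuc π =
    ∏ i ∈ Finset.range n, ((i : ℝ) + 1 + s) := by
  rw [← sum_Sst, ← Equiv.sum_comp (Equiv.inv (Equiv.Perm (Fin (n + 1)))) (fun τ => s ^ Sst τ)]
  simp [simsuc_eq]

/-! cycle part -/

lemma cyc_add {n : ℕ} (σ : Equiv.Perm (Fin n)) :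
    cyc σ + σ.support.card = σ.cycleType.card + n := by
  have h : fixStat σ + σ.support.card = n := by
    have : σ.support = Finset.univ.filter fun i => ¬ σ i = i := by
      ext; simp
    rw [this, fixStat, Finset.card_filter_add_card_filter_not]
    simp
  unfold cyc; omega

lemma cyc_le {n : ℕ} (σ : Equiv.Perm (Fin n)) : cyc σ ≤ n := by
  have h := cyc_add σ
  rw [← Equiv.Perm.sum_cycleType] at h
  have : σ.cycleType.card • 1 ≤ σ.cycleType.sum :=
    Multiset.card_nsmul_le_sum fun x hx => (Equiv.Perm.one_lt_of_mem_cycleType hx).le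
  simp at this
  omega

lemma cyc_disjoint_mul {n : ℕ} {f g : Equiv.Perm (Fin n)} (h : f.Disjoint g) :
    cyc (f * g) + f.support.card + g.support.card =
      f.cycleType.card + g.cycleType.card + n := by
  have := cyc_add (f * g)
  rw [h.card_support_mul, h.cycleType_mul, Multiset.card_add] at this
  omega

lemma cyc_swap_mul {n : ℕ} (g : Equiv.Perm (Fin n)) (x : Fin n) (hx : g x ≠ x) :
    cyc (Equiv.swap x (g x) * g) = cyc g + 1 := by
  set f := g.cycleOf x with hf
  have hfc : f.IsCycle := Equiv.Perm.isCycle_cycleOf g hx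
  have hfx : f x = g x := Equiv.Perm.cycleOf_apply_self g x
  set r := g * f⁻¹ with hr
  have hd : f.Disjoint r := (Equiv.Perm.disjoint_mul_inv_of_mem_cycleFactorsFinset
    (Equiv.Perm.cycleOf_mem_cycleFactorsFinset_iff.2 (by simpa using hx))).symm
  have hg : g = f * r := by
    rw [hd.commute.eq, hr]; simp
  have h1 := cyc_disjoint_mul hd
  rw [← hg, hfc.cycleType, Multiset.card_singleton] at h1
  have hg2 : Equiv.swap x (g x) * g = (Equiv.swap x (f x) * f) * r := by
    rw [hfx, mul_assoc, ← hg]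
  rw [hg2]
  have hfx' : f x ≠ x := by rwa [hfx]
  by_cases hff : f (f x) = x
  · have hs : f = Equiv.swap x (f x) := hfc.eq_swap_of_apply_apply_eq_self hfx' hff
    have : Equiv.swap x (f x) * f = 1 := by
      nth_rewrite 2 [hs]; simp
    rw [this, one_mul]
    have h2 := cyc_add r
    have : f.support.card = 2 := by
      rw [hs]; exact Equiv.Perm.card_support_swap hfx'.symm
    omega
  · have hc := hfc.swap_mul hfx' hff
    have hsup : (Equiv.swap x (f x) * f).support = f.support \ {x} :=
      Equiv.Perm.support_swap_mul_eq f x hff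
    have hd2 : (Equiv.swap x (f x) * f).Disjoint r := by
      rw [Equiv.Perm.disjoint_iff_disjoint_support, hsup]
      exact (Equiv.Perm.disjoint_iff_disjoint_support.1 hd).mono_left Finset.sdiff_subset
    have h2 := cyc_disjoint_mul hd2
    rw [hc.cycleType, Multiset.card_singleton, hsup] at h2
    have hm : x ∈ f.support := by simpa using hfx'
    have := Finset.card_sdiff_add_card_eq_card (Finset.singleton_subset_iff.2 hm)
    simp only [Finset.card_singleton] at this
    omega

lemma cyc_dec_zero {n : ℕ} (e : Equiv.Perm (Fin n)) :
    cyc (Equiv.Perm.decomposeFin.symm (0, e)) = cyc e + 1 := by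
  have h : Equiv.Perm.decomposeFin.symm (0, e) = 
      e.extendDomain (finSuccAboveEquiv (0 : Fin (n + 1))) := by
    ext i
    refine Fin.cases ?_ (fun j => ?_) i
    · rw [Equiv.Perm.extendDomain_apply_not_subtype _ _ (by simp)]
      simp
    · have := Equiv.Perm.extendDomain_apply_image e (finSuccAboveEquiv (0 : Fin (n + 1))) j
      simp [finSuccAboveEquiv_apply] at this
      rw [this]; simp
  have h1 := cyc_add (Equiv.Perm.decomposeFin.symm (0, e))
  have h2 := cyc_add e
  rw [h, Equiv.Perm.card_support_extend_domain, Equiv.Perm.cycleType_extendDomain] at h1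
  rw [h]
  omega

lemma cyc_dec {n : ℕ} (p : Fin (n + 1)) (hp : p ≠ 0) (e : Equiv.Perm (Fin n)) :
    cyc (Equiv.Perm.decomposeFin.symm (p, e)) = cyc e := by
  have h0 : Equiv.Perm.decomposeFin.symm (p, e) 0 = p := by simp
  have h := cyc_swap_mul (Equiv.Perm.decomposeFin.symm (p, e)) 0 (by rwa [h0])
  have h2 : Equiv.swap 0 p * Equiv.Perm.decomposeFin.symm (p, e) =
      Equiv.Perm.decomposeFin.symm (0, e) := by
    ext i
    refine Fin.cases ?_ (fun j => ?_) i <;> simp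
  rw [h0, h2, cyc_dec_zero] at h
  omega

lemma sum_cyc (n : ℕ) (s : ℝ) : ∑ σ : Equiv.Perm (Fin n), (1 + s) ^ cyc σ =
    ∏ i ∈ Finset.range n, ((i : ℝ) + 1 + s) := by
  induction n with
  | zero =>
    have h : ∀ τ : Equiv.Perm (Fin 0), cyc τ = 0 := fun τ => by
      have := cyc_le τ; omega
    simp [h]
  | succ n ih =>
    rw [Finset.prod_range_succ, ← ih, ← Equiv.Perm.decomposeFin.symm.sum_comp,
      Fintype.sum_prod_type_right, Finset.sum_mul]
    refine Finset.sum_congr rfl fun τ _ => ?_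
    rw [Fin.sum_univ_succ, cyc_dec_zero]
    simp only [cyc_dec _ (Fin.succ_ne_zero _)]
    simp; ring

/-- `Σ_{π ∈ S_{n+1}} s^simsuc(π) = Σ_{σ ∈ S_n} (1+s)^cyc(σ)
= (1+s)(2+s)⋯(n+s) = Σ_{k=0}^n c(n,k) (s+1)^k`, where `c(n,k)` is the unsigned
Stirling number of the first kind. -/
theorem statement17 (n : ℕ) (s : ℝ) :
    (∑ π : Equiv.Perm (Fin (n + 1)), s ^ simsuc π =
        ∑ σ : Equiv.Perm (Fin n), (1 + s) ^ cyc σ) ∧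
      (∑ σ : Equiv.Perm (Fin n), (1 + s) ^ cyc σ =
        ∏ i ∈ Finset.range n, ((i : ℝ) + 1 + s)) ∧
      (∏ i ∈ Finset.range n, ((i : ℝ) + 1 + s) =
        ∑ k ∈ Finset.range (n + 1),
          ((Finset.univ.filter fun σ : Equiv.Perm (Fin n) => cyc σ = k).card : ℝ) *
            (s + 1) ^ k) := by
  refine ⟨by rw [sum_simsuc, sum_cyc], sum_cyc n s, ?_⟩
  rw [← sum_cyc, ← Finset.sum_fiberwise_of_maps_to (g := cyc) (t := Finset.range (n + 1))
    (fun σ _ => Finset.mem_range.2 (Nat.lt_succ_of_le (cyc_le σ)))]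
  refine Finset.sum_congr rfl fun k _ => ?_
  rw [Finset.sum_congr rfl (g := fun _ => (s + 1) ^ k)]
  · simp
  · intro σ hσ
    rw [(Finset.mem_filter.1 hσ).2, add_comm]

end SucEuler
end
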